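/- arXiv:1707.05669 — 9 statements merged into one kernel-verified Lean document; each statement's English description precedes it below -/
import Mathlib

section
/- The algebra B(𝔥⊕𝔎) equipped with the series product is a *-monoid. Precisely: (i) the series product is associative, and for all F₁, F₂, F₃ ∈ B(𝔥⊕𝔎), F₁ ⋄ (F₂ ⋄ F₃) = (F₁ ⋄ F₂) ⋄ F₃ = F₁ + F₂ + F₃ + F₁ΔF₂ + F₁ΔF₃ + F₂ΔF₃ + F₁ΔF₂ΔF₃ = F₁ ⋄ F₃ + (I + F₁Δ)F₂(ΔF₃ + I); (ii) the zero operator is a two-sided identity element for ⋄; (iii) the operator adjoint is an involution for ⋄, i.e. (F₁ ⋄ F₂)* = F₂* ⋄ F₁* for all F₁, F₂ ∈ B(𝔥⊕𝔎). -/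
noncomputable section

open ContinuousLinearMap

namespace QS

variable (H K : Type*) [NormedAddCommGroup H] [InnerProductSpace ℂ H] [CompleteSpace H]
  [NormedAddCommGroup K] [InnerProductSpace ℂ K] [CompleteSpace K]

/-- The Hilbert space direct sum `𝔥 ⊕ 𝔎`. -/
abbrev E := WithLp 2 (H × K)

def eE : E H K ≃L[ℂ] H × K := WithLp.prodContinuousLinearEquiv 2 ℂ H K

/-- Inclusion of `𝔥` into `𝔥 ⊕ 𝔎`. -/
def inH : H →L[ℂ] E H K := ((eE H K).symm : H × K →L[ℂ] E H K).comp (ContinuousLinearMap.inl ℂ H K)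

/-- Inclusion of `𝔎` into `𝔥 ⊕ 𝔎`. -/
def inK : K →L[ℂ] E H K := ((eE H K).symm : H × K →L[ℂ] E H K).comp (ContinuousLinearMap.inr ℂ H K)

/-- Projection of `𝔥 ⊕ 𝔎` onto `𝔥`. -/
def prH : E H K →L[ℂ] H := (ContinuousLinearMap.fst ℂ H K).comp ((eE H K) : E H K →L[ℂ] H × K)

/-- Projection of `𝔥 ⊕ 𝔎` onto `𝔎`. -/
def prK : E H K →L[ℂ] K := (ContinuousLinearMap.snd ℂ H K).comp ((eE H K) : E H K →L[ℂ] H × K)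

/-- `Δ`, the orthogonal projection onto `{0} ⊕ 𝔎`. -/
def Dl : E H K →L[ℂ] E H K := (inK H K).comp (prK H K)

/-- `Δ⊥ = I - Δ`. -/
def Dp : E H K →L[ℂ] E H K := 1 - Dl H K

variable {H K}

/-- The series product `F₁ ⋄ F₂ := F₁ + F₁ Δ F₂ + F₂`. -/
def sp (F₁ F₂ : E H K →L[ℂ] E H K) : E H K →L[ℂ] E H K := F₁ + F₁ * Dl H K * F₂ + F₂

/-- Operator order: `S ≤ T` iff `T - S` is a nonnegative selfadjoint operator. -/
def opLe (S T : E H K →L[ℂ] E H K) : Prop := (T - S).IsPositive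

/-- `F` has block matrix form `[K, M; L, N]`, i.e. `F (u ⊕ ζ) = (K u + M ζ) ⊕ (L u + N ζ)`. -/
def HasBlock (F : E H K →L[ℂ] E H K) (Kc : H →L[ℂ] H) (M : K →L[ℂ] H)
    (L : H →L[ℂ] K) (N : K →L[ℂ] K) : Prop :=
  ∀ (u : H) (ζ : K), F ((WithLp.equiv 2 (H × K)).symm (u, ζ)) =
    (WithLp.equiv 2 (H × K)).symm (Kc u + M ζ, L u + N ζ)

/-- The operator on `𝔥 ⊕ 𝔎` with block matrix form `[K, M; L, N]`. -/
def blockOf (Kc : H →L[ℂ] H) (M : K →L[ℂ] H) (L : H →L[ℂ] K) (N : K →L[ℂ] K) :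
    E H K →L[ℂ] E H K :=
  (inH H K) ∘L Kc ∘L (prH H K) + (inH H K) ∘L M ∘L (prK H K) +
    (inK H K) ∘L L ∘L (prH H K) + (inK H K) ∘L N ∘L (prK H K)

theorem adjoint_Dl : adjoint (Dl H K) = Dl H K := by
  symm
  rw [eq_adjoint_iff]
  intro x y
  simp [Dl, inK, prK, eE, WithLp.prod_inner_apply]

/-- `(B(𝔥⊕𝔎), ⋄)` is a *-monoid: associativity (with the two explicit
common expressions), `0` is a two-sided identity, and the adjoint is an involution. -/
theorem series_product_star_monoid
    (F F₁ F₂ F₃ : E H K →L[ℂ] E H K) :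
    sp F₁ (sp F₂ F₃) = sp (sp F₁ F₂) F₃ ∧
    sp F₁ (sp F₂ F₃) =
      F₁ + F₂ + F₃ + (F₁ * Dl H K * F₂ + F₁ * Dl H K * F₃ + F₂ * Dl H K * F₃) +
        F₁ * Dl H K * F₂ * Dl H K * F₃ ∧
    sp F₁ (sp F₂ F₃) = sp F₁ F₃ + (1 + F₁ * Dl H K) * F₂ * (Dl H K * F₃ + 1) ∧
    sp 0 F = F ∧ sp F 0 = F ∧
    adjoint (sp F₁ F₂) = sp (adjoint F₂) (adjoint F₁) := by
  refine ⟨?_, ?_, ?_, ?_, ?_, ?_⟩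
  · simp only [sp]
    noncomm_ring
  · simp only [sp]
    noncomm_ring
  · simp only [sp]
    noncomm_ring
  · simp [sp]
  · simp [sp]
  · simp only [sp, map_add, mul_def, adjoint_comp, adjoint_Dl, comp_assoc]
    abel

end QS
end
end

section
/- An operator F ∈ B(𝔥⊕𝔎) has a two-sided inverse with respect to the series product (i.e. there exists G ∈ B(𝔥⊕𝔎) with F ⋄ G = 0 = G ⋄ F) if and only if I + ΔFΔ is invertible in B(𝔥⊕𝔎); equivalently, if and only if I + FΔ is invertible; equivalently, if and only if I + ΔF is invertible. In that case the ⋄-inverse is unique and equals −(I + FΔ)^{−1}F = −F(I + ΔF)^{−1}. -/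
noncomputable section

open ContinuousLinearMap

namespace QS

variable (H K : Type*) [NormedAddCommGroup H] [InnerProductSpace ℂ H] [CompleteSpace H]
  [NormedAddCommGroup K] [InnerProductSpace ℂ K] [CompleteSpace K]

variable {H K}

section Ring

variable {R : Type*} [Ring R]

theorem isUnit_one_add_mul_swap {a b : R} : IsUnit (1 + a * b) ↔ IsUnit (1 + b * a) := by
  have key (a b : R) (h : IsUnit (1 + a * b)) : IsUnit (1 + b * a) := by
    obtain ⟨v, hv, hv'⟩ := isUnit_iff_exists.mp h
    refine isUnit_iff_exists.mpr ⟨1 - b * v * a, ?_, ?_⟩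
    · calc (1 + b * a) * (1 - b * v * a) = 1 + b * a - b * ((1 + a * b) * v) * a := by noncomm_ring
        _ = 1 := by rw [hv]; noncomm_ring
    · calc (1 - b * v * a) * (1 + b * a) = 1 + b * a - b * (v * (1 + a * b)) * a := by noncomm_ring
        _ = 1 := by rw [hv']; noncomm_ring
  exact ⟨key a b, key b a⟩

theorem one_add_mul_mul_one_add_mul_eq_one {d f g : R} (h : f + f * d * g + g = 0) :
    (1 + f * d) * (1 + g * d) = 1 := by
  calc (1 + f * d) * (1 + g * d) = 1 + (f + f * d * g + g) * d := by noncomm_ring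
    _ = 1 := by rw [h, zero_mul, add_zero]

theorem exists_add_mul_mul_add_eq_zero_iff {d f : R} :
    (∃ g, f + f * d * g + g = 0 ∧ g + g * d * f + f = 0) ↔ IsUnit (1 + f * d) := by
  constructor
  · rintro ⟨g, h, h'⟩
    exact isUnit_iff_exists.mpr ⟨1 + g * d, one_add_mul_mul_one_add_mul_eq_one h,
      one_add_mul_mul_one_add_mul_eq_one h'⟩
  · intro h
    obtain ⟨v, hv, hv'⟩ := isUnit_iff_exists.mp h
    refine ⟨-(v * f), ?_, ?_⟩
    · calc f + f * d * -(v * f) + -(v * f) = f - (1 + f * d) * v * f := by noncomm_ring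
        _ = 0 := by rw [hv, one_mul, sub_self]
    · calc -(v * f) + -(v * f) * d * f + f = f - v * (1 + f * d) * f := by noncomm_ring
        _ = 0 := by rw [hv', one_mul, sub_self]

theorem eq_neg_inverse_mul {d f g : R} (hu : IsUnit (1 + f * d)) (h : f + f * d * g + g = 0) :
    g = -(Ring.inverse (1 + f * d) * f) := by
  have hg : (1 + f * d) * g = -f :=
    eq_neg_of_add_eq_zero_left (by rw [← h]; noncomm_ring)
  rw [← mul_neg, ← hg, Ring.inverse_mul_cancel_left _ _ hu]

theorem eq_neg_mul_inverse {d f g : R} (hu : IsUnit (1 + d * f)) (h : g + g * d * f + f = 0) :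
    g = -(f * Ring.inverse (1 + d * f)) := by
  have hg : g * (1 + d * f) = -f :=
    eq_neg_of_add_eq_zero_left (by rw [← h]; noncomm_ring)
  rw [← neg_mul, ← hg, Ring.mul_inverse_cancel_right _ _ hu]

end Ring

/-- `F` has a two-sided ⋄-inverse iff `I + ΔFΔ` is invertible, iff
`I + FΔ` is invertible, iff `I + ΔF` is invertible; and in that case the ⋄-inverse is
unique and equals `-(I + FΔ)⁻¹ F = -F (I + ΔF)⁻¹`. -/
theorem series_product_inverse (F : E H K →L[ℂ] E H K) :
    ((∃ G, sp F G = 0 ∧ sp G F = 0) ↔ IsUnit (1 + Dl H K * F * Dl H K)) ∧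
    ((∃ G, sp F G = 0 ∧ sp G F = 0) ↔ IsUnit (1 + F * Dl H K)) ∧
    ((∃ G, sp F G = 0 ∧ sp G F = 0) ↔ IsUnit (1 + Dl H K * F)) ∧
    (∀ G, sp F G = 0 → sp G F = 0 →
      G = -(Ring.inverse (1 + F * Dl H K) * F) ∧
      G = -(F * Ring.inverse (1 + Dl H K * F))) := by
  have hF : (∃ G, sp F G = 0 ∧ sp G F = 0) ↔ IsUnit (1 + F * Dl H K) :=
    exists_add_mul_mul_add_eq_zero_iff
  have hswap : IsUnit (1 + F * Dl H K) ↔ IsUnit (1 + Dl H K * F) := isUnit_one_add_mul_swap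
  have hD : Dl H K * Dl H K = Dl H K := by
    ext x
    simp [Dl, inK, prK]
  have hcorner : IsUnit (1 + Dl H K * F * Dl H K) ↔ IsUnit (1 + Dl H K * F) := by
    rw [isUnit_one_add_mul_swap, ← mul_assoc, hD]
  refine ⟨hF.trans (hswap.trans hcorner.symm), hF, hF.trans hswap, fun G h h' => ?_⟩
  have hu := hF.mp ⟨G, h, h'⟩
  exact ⟨eq_neg_inverse_mul hu h, eq_neg_mul_inverse (hswap.mp hu) h'⟩

end QS
end
end

section
/- Set 𝔠 := {F : F* ⋄ F ≤ 0}, 𝔦 := {F : F* ⋄ F = 0}, 𝔲 := {F : F* ⋄ F = 0 = F ⋄ F*}, 𝔷 := {F : F = Δ⊥FΔ⊥} and 𝔮𝔠 := {F : F* ⋄ F ≤ 2βΔ⊥ for some β ∈ ℝ}. Then: (i) every F ∈ 𝔲 has two-sided ⋄-inverse F*; (ii) an element F ∈ 𝔠 has a ⋄-inverse lying in 𝔠 if and only if F ∈ 𝔲, and an element F ∈ 𝔦 has a ⋄-inverse lying in 𝔦 if and only if F ∈ 𝔲; (iii) an element F ∈ 𝔮𝔠 has a ⋄-inverse lying in 𝔮𝔠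 if and only if F = U + Z for some U ∈ 𝔲 and Z ∈ 𝔷; (iv) 𝔦 ∩ 𝔷 = 𝔲 ∩ 𝔷 and this set consists exactly of the operators iH ⊕ 0 for H ∈ B(𝔥) selfadjoint. -/
noncomputable section

open ContinuousLinearMap

namespace QS

variable (H K : Type*) [NormedAddCommGroup H] [InnerProductSpace ℂ H] [CompleteSpace H]
  [NormedAddCommGroup K] [InnerProductSpace ℂ K] [CompleteSpace K]

variable {H K}

/-- The series product `x ⋄ y := x + x d y + y` on a ring, relative to an element `d`. -/
def seriesProd {A : Type*} [Ring A] (d x y : A) : A := x + x * d * y + y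

section Ring

variable {A : Type*} [Ring A] {d x y z : A}

theorem seriesProd_assoc (d x y z : A) :
    seriesProd d (seriesProd d x y) z = seriesProd d x (seriesProd d y z) := by
  simp only [seriesProd]; noncomm_ring

theorem seriesProd_zero (d x : A) : seriesProd d x 0 = x := by simp [seriesProd]

theorem zero_seriesProd (d x : A) : seriesProd d 0 x = x := by simp [seriesProd]

theorem eq_of_seriesProd_eq_zero (hyx : seriesProd d y x = 0) (hxz : seriesProd d x z = 0) :
    y = z := by
  have h := seriesProd_assoc d y x z
  rwa [hyx, hxz, zero_seriesProd, seriesProd_zero, eq_comm] at h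

theorem mul_eq_zero_of_eq_compl_mul_compl (hd : d * d = d)
    (hz : z = (1 - d) * z * (1 - d)) : d * z = 0 ∧ z * d = 0 := by
  have h₁ : d * (1 - d) = 0 := by rw [mul_sub, mul_one, hd, sub_self]
  have h₂ : (1 - d) * d = 0 := by rw [sub_mul, one_mul, hd, sub_self]
  constructor
  · rw [hz, ← mul_assoc, ← mul_assoc, h₁, zero_mul, zero_mul]
  · rw [hz, mul_assoc, h₂, mul_zero]

variable [StarRing A]

/-- Congruence formula for `(x ⋄ y)* ⋄ (x ⋄ y)` when `x ⋄ y = 0`. -/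
theorem seriesProd_star_self_eq_neg (hd : star d = d) (h : seriesProd d x y = 0) :
    seriesProd d (star y) y =
      -(star (1 + d * y) * seriesProd d (star x) x * (1 + d * y)) := by
  have h' : seriesProd d (star y) (star x) = 0 := by
    simpa [seriesProd, hd, mul_assoc, add_comm, add_left_comm] using congrArg star h
  have hprod : seriesProd d (seriesProd d (star y) (star x)) (seriesProd d x y) = 0 := by
    rw [h, h', seriesProd_zero]
  have hexp : seriesProd d (seriesProd d (star y) (star x)) (seriesProd d x y) =
      seriesProd d (star y) y +
        star (1 + d * y) * seriesProd d (star x) x * (1 + d * y) := by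
    simp only [seriesProd, star_add, star_mul, star_one, hd]
    noncomm_ring
  exact eq_neg_of_add_eq_zero_left (hexp.symm.trans hprod)

theorem isSelfAdjoint_seriesProd_star_self (hd : star d = d) (x : A) :
    IsSelfAdjoint (seriesProd d (star x) x) := by
  simp only [IsSelfAdjoint, seriesProd, star_add, star_mul, star_star, hd]
  noncomm_ring

theorem seriesProd_self_star_eq_zero (hx : seriesProd d (star x) x = 0)
    (hxy : seriesProd d x y = 0) : seriesProd d x (star x) = 0 := by
  rwa [eq_of_seriesProd_eq_zero hx hxy]

theorem seriesProd_add_star_sub (x : A) (hz : d * z = 0 ∧ z * d = 0)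
    (hx : seriesProd d x (star x) = 0) : seriesProd d (x + z) (star x - z) = 0 := by
  rw [← hx]
  simp only [seriesProd, add_mul, mul_sub, mul_assoc, hz.1]
  simp only [← mul_assoc, hz.2, zero_mul, mul_zero]
  abel

theorem seriesProd_star_sub_add (x : A) (hz : d * z = 0 ∧ z * d = 0)
    (hx : seriesProd d (star x) x = 0) : seriesProd d (star x - z) (x + z) = 0 := by
  rw [← hx]
  simp only [seriesProd, sub_mul, mul_add, mul_assoc, hz.1]
  simp only [← mul_assoc, hz.2, zero_mul, mul_zero]
  abel

end Ring

section CStarAlgebra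

variable {A : Type*} [CStarAlgebra A] [PartialOrder A] [StarOrderedRing A] {d x y : A}

theorem mul_eq_zero_of_nonneg_of_conjugate_nonpos {p : A} (hp : 0 ≤ p)
    (h : star d * p * d ≤ 0) : p * d = 0 := by
  obtain ⟨s, rfl⟩ := CStarAlgebra.nonneg_iff_eq_star_mul_self.mp hp
  have hs : star (s * d) * (s * d) = 0 := by
    refine le_antisymm ?_ (star_mul_self_nonneg _)
    simpa [star_mul, mul_assoc] using h
  rw [mul_assoc, CStarRing.star_mul_self_eq_zero_iff _ |>.mp hs, mul_zero]

theorem seriesProd_star_self_eq_zero_of_nonpos (hd : star d = d)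
    (hx : seriesProd d (star x) x ≤ 0) (hy : seriesProd d (star y) y ≤ 0)
    (hyx : seriesProd d y x = 0) : seriesProd d (star x) x = 0 := by
  refine le_antisymm hx ?_
  rw [seriesProd_star_self_eq_neg hd hyx, neg_nonneg]
  simpa using star_left_conjugate_le_conjugate hy (1 + d * x)

/-- Quasicontractive invertible elements have defect supported on the complement of `d`. -/
theorem seriesProd_star_self_mul_eq_zero {a b : ℂ} (hd : star d = d) (hdd : d * d = d)
    (hx : seriesProd d (star x) x ≤ a • (1 - d)) (hy : seriesProd d (star y) y ≤ b • (1 - d))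
    (hyx : seriesProd d y x = 0) : seriesProd d (star x) x * d = 0 := by
  have h₁ : d * (1 - d) = 0 := by rw [mul_sub, mul_one, hdd, sub_self]
  have h₂ : (1 - d) * d = 0 := by rw [sub_mul, one_mul, hdd, sub_self]
  have hconj : star (1 + d * x) * (b • (1 - d)) * (1 + d * x) = b • (1 - d) := by
    rw [mul_smul_comm, smul_mul_assoc, star_add, star_mul, star_one, hd, add_mul, mul_assoc _ d,
      h₁, mul_zero, add_zero, one_mul, mul_add, mul_one, ← mul_assoc, h₂, zero_mul, add_zero]
  have hlow : 0 ≤ seriesProd d (star x) x + b • (1 - d) := by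
    rw [seriesProd_star_self_eq_neg hd hyx, neg_add_eq_sub, sub_nonneg]
    simpa only [hconj] using star_left_conjugate_le_conjugate hy (1 + d * x)
  have hup : star d * (seriesProd d (star x) x + b • (1 - d)) * d ≤ 0 := by
    have h := star_left_conjugate_le_conjugate hx d
    rw [mul_smul_comm, smul_mul_assoc, mul_assoc _ (1 - d), h₂, mul_zero, smul_zero] at h
    rwa [mul_add, add_mul, mul_smul_comm, smul_mul_assoc, mul_assoc _ (1 - d), h₂, mul_zero,
      smul_zero, add_zero]
  simpa [add_mul, h₂] using mul_eq_zero_of_nonneg_of_conjugate_nonpos hlow hup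

theorem exists_eq_add_of_seriesProd_inverse {a b : ℂ} (hd : star d = d) (hdd : d * d = d)
    (hx : seriesProd d (star x) x ≤ a • (1 - d)) (hy : seriesProd d (star y) y ≤ b • (1 - d))
    (hxy : seriesProd d x y = 0) (hyx : seriesProd d y x = 0) :
    ∃ u z : A, (seriesProd d (star u) u = 0 ∧ seriesProd d u (star u) = 0) ∧
      z = (1 - d) * z * (1 - d) ∧ x = u + z := by
  set q := seriesProd d (star x) x with hq
  have hqs : star q = q := isSelfAdjoint_seriesProd_star_self hd x
  have hqd : q * d = 0 := seriesProd_star_self_mul_eq_zero hd hdd hx hy hyx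
  have hdq : d * q = 0 := by simpa [hqs, hd] using congrArg star hqd
  set z : A := (2⁻¹ : ℂ) • q with hz
  have hzs : star z = z := by simp [hz, hqs]
  have hzd : z * d = 0 := by rw [hz, smul_mul_assoc, hqd, smul_zero]
  have hdz : d * z = 0 := by rw [hz, mul_smul_comm, hdq, smul_zero]
  have hzz : z + z = q := by rw [hz, ← add_smul]; norm_num
  have hu : seriesProd d (star (x - z)) (x - z) = 0 := by
    have : seriesProd d (star (x - z)) (x - z) = q - (z + z) := by
      simp only [hq, seriesProd, star_sub, hzs, sub_mul, mul_sub, mul_assoc, hdz]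
      simp only [← mul_assoc, hzd, zero_mul, mul_zero]
      abel
    rw [this, hzz, sub_self]
  have huy : seriesProd d (x - z) (z + y) = 0 := by
    rw [← hxy]
    simp only [seriesProd, sub_mul, mul_add, mul_assoc, hdz]
    simp only [← mul_assoc, hzd, zero_mul, mul_zero]
    abel
  refine ⟨x - z, z, ⟨hu, seriesProd_self_star_eq_zero hu huy⟩, ?_, (sub_add_cancel x z).symm⟩
  simp [sub_mul, mul_sub, hzd, hdz]

/-- Subtracting an element supported on the complement of `d` from an isometry preserves
quasicontractivity. -/
theorem exists_seriesProd_star_sub_le {u z : A} (hd : star d = d) (hdd : d * d = d)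
    (hu : seriesProd d (star u) u = 0) (hz : z = (1 - d) * z * (1 - d)) :
    ∃ β : ℝ, seriesProd d (star (u - z)) (u - z) ≤ ((2 * β : ℝ) : ℂ) • (1 - d) := by
  obtain ⟨hdz, hzd⟩ := mul_eq_zero_of_eq_compl_mul_compl hdd hz
  have hzd' : star z * d = 0 := by simpa [hd] using congrArg star hdz
  have hdz' : d * star z = 0 := by simpa [hd] using congrArg star hzd
  have hs : IsSelfAdjoint (-(star z + z)) := by
    simp [IsSelfAdjoint, add_comm]
  refine ⟨‖-(star z + z)‖ / 2, ?_⟩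
  have heq : seriesProd d (star (u - z)) (u - z) = -(star z + z) := by
    rw [← zero_add (-(star z + z)), ← hu]
    simp only [seriesProd, star_sub, sub_mul, mul_sub, mul_assoc, hdz]
    simp only [← mul_assoc, hzd', zero_mul, mul_zero]
    abel
  have hcompl : star (1 - d) * (-(star z + z)) * (1 - d) = -(star z + z) := by
    simp [hd, sub_mul, mul_sub, mul_add, add_mul, mul_neg, neg_mul, hdz, hzd, hdz', hzd']
  have hone : star (1 - d) * algebraMap ℝ A ‖-(star z + z)‖ * (1 - d) =
      ((2 * (‖-(star z + z)‖ / 2) : ℝ) : ℂ) • (1 - d) := by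
    rw [mul_div_cancel₀ _ two_ne_zero, Algebra.algebraMap_eq_smul_one, mul_smul_comm,
      smul_mul_assoc, Complex.coe_smul]
    simp [hd, mul_sub, sub_mul, hdd]
  rw [heq, ← hone]
  nth_rewrite 1 [← hcompl]
  exact star_left_conjugate_le_conjugate hs.le_algebraMap_norm_self _

end CStarAlgebra

omit [CompleteSpace H] [CompleteSpace K] in
theorem Dl_mul_Dl : Dl H K * Dl H K = Dl H K := rfl

theorem star_Dl : star (Dl H K) = Dl H K := by
  rw [star_eq_adjoint, eq_comm, eq_adjoint_iff]
  intro x y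
  have h (x : E H K) : (Dl H K x).ofLp = (0, x.snd) := rfl
  simp [WithLp.prod_inner_apply, h]

omit [CompleteSpace H] [CompleteSpace K] in
theorem Dp_apply (x : E H K) : Dp H K x = (WithLp.equiv 2 (H × K)).symm (x.fst, 0) := by
  refine WithLp.ofLp_injective 2 (Prod.ext ?_ ?_)
  · exact sub_zero x.fst
  · exact sub_self x.snd

omit [CompleteSpace H] [CompleteSpace K] in
theorem HasBlock.apply {F : E H K →L[ℂ] E H K} {T : H →L[ℂ] H} (h : HasBlock F T 0 0 0)
    (x : E H K) : F x = (WithLp.equiv 2 (H × K)).symm (T x.fst, 0) := by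
  refine (h x.fst x.snd).trans ?_
  simp

omit [CompleteSpace H] [CompleteSpace K] in
theorem HasBlock.eq_compl_mul_compl {F : E H K →L[ℂ] E H K} {T : H →L[ℂ] H}
    (h : HasBlock F T 0 0 0) : F = Dp H K * F * Dp H K := by
  ext1 x
  simp [h.apply, Dp_apply]

omit [CompleteSpace H] [CompleteSpace K] in
theorem hasBlock_of_eq_compl_mul_compl {F : E H K →L[ℂ] E H K}
    (h : F = Dp H K * F * Dp H K) : HasBlock F (prH H K ∘L F ∘L inH H K) 0 0 0 := by
  intro u ζ
  rw [h]
  simp only [mul_apply_eq_comp, Dp_apply, comp_apply]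
  simp [prH, inH, eE]

theorem HasBlock.inner_adjoint_add_apply {F : E H K →L[ℂ] E H K} {T : H →L[ℂ] H}
    (h : HasBlock F (Complex.I • T) 0 0 0) (x y : E H K) :
    inner ℂ ((adjoint F + F) x) y =
      Complex.I * (inner ℂ x.fst (T y.fst) - inner ℂ (T x.fst) y.fst) := by
  rw [add_apply, inner_add_left, adjoint_inner_left, h.apply, h.apply]
  simp [WithLp.prod_inner_apply, inner_smul_left, inner_smul_right]
  ring

theorem HasBlock.adjoint_add_eq_zero_iff {F : E H K →L[ℂ] E H K} {T : H →L[ℂ] H}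
    (h : HasBlock F (Complex.I • T) 0 0 0) : adjoint F + F = 0 ↔ IsSelfAdjoint T := by
  rw [isSelfAdjoint_iff_isSymmetric]
  constructor
  · intro h0 u v
    have := h.inner_adjoint_add_apply (inH H K u) (inH H K v)
    rw [h0, zero_apply, inner_zero_left, eq_comm, mul_eq_zero, sub_eq_zero] at this
    exact (this.resolve_left Complex.I_ne_zero).symm
  · intro hT
    ext1 x
    refine ext_inner_right ℂ fun y => ?_
    rw [h.inner_adjoint_add_apply, zero_apply, inner_zero_left, mul_eq_zero, sub_eq_zero]
    exact Or.inr (hT x.fst y.fst).symm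

/-- Invertible elements of the submonoids `𝔠`, `𝔦`, `𝔮𝔠`, and the
identification of `𝔦 ∩ 𝔷 = 𝔲 ∩ 𝔷` with `{iH ⊕ 0 : H selfadjoint}`. -/
theorem series_product_invertibles (F : E H K →L[ℂ] E H K) :
    ((sp (adjoint F) F = 0 ∧ sp F (adjoint F) = 0) →
      (sp F (adjoint F) = 0 ∧ sp (adjoint F) F = 0)) ∧
    (opLe (sp (adjoint F) F) 0 →
      ((∃ G, opLe (sp (adjoint G) G) 0 ∧ sp F G = 0 ∧ sp G F = 0) ↔
        (sp (adjoint F) F = 0 ∧ sp F (adjoint F) = 0))) ∧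
    (sp (adjoint F) F = 0 →
      ((∃ G, sp (adjoint G) G = 0 ∧ sp F G = 0 ∧ sp G F = 0) ↔
        (sp (adjoint F) F = 0 ∧ sp F (adjoint F) = 0))) ∧
    ((∃ β : ℝ, opLe (sp (adjoint F) F) (((2 * β : ℝ) : ℂ) • Dp H K)) →
      ((∃ G, (∃ β : ℝ, opLe (sp (adjoint G) G) (((2 * β : ℝ) : ℂ) • Dp H K)) ∧
          sp F G = 0 ∧ sp G F = 0) ↔
        (∃ U Z : E H K →L[ℂ] E H K, (sp (adjoint U) U = 0 ∧ sp U (adjoint U) = 0) ∧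
          Z = Dp H K * Z * Dp H K ∧ F = U + Z))) ∧
    ((sp (adjoint F) F = 0 ∧ F = Dp H K * F * Dp H K) ↔
      ((sp (adjoint F) F = 0 ∧ sp F (adjoint F) = 0) ∧ F = Dp H K * F * Dp H K)) ∧
    ((sp (adjoint F) F = 0 ∧ F = Dp H K * F * Dp H K) ↔
      (∃ T : H →L[ℂ] H, IsSelfAdjoint T ∧ HasBlock F (Complex.I • T) 0 0 0)) := by
  have hd := star_Dl (H := H) (K := K)
  have hdd := Dl_mul_Dl (H := H) (K := K)
  have hz (h : F = Dp H K * F * Dp H K) (X : E H K →L[ℂ] E H K) :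
      sp F X = F + X ∧ sp X F = X + F := by
    obtain ⟨h₁, h₂⟩ := mul_eq_zero_of_eq_compl_mul_compl hdd h
    simp [sp, mul_assoc, h₁, h₂]
  refine ⟨And.symm, fun hF => ⟨?_, ?_⟩, fun hF => ⟨?_, ?_⟩, ?_, ?_, ?_⟩
  · rintro ⟨G, hG, hFG, hGF⟩
    have h := seriesProd_star_self_eq_zero_of_nonpos hd hF hG hGF
    exact ⟨h, seriesProd_self_star_eq_zero h hFG⟩
  · rintro ⟨h₁, h₂⟩
    refine ⟨adjoint F, ?_, h₂, h₁⟩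
    rw [adjoint_adjoint, h₂]
    exact le_refl (0 : E H K →L[ℂ] E H K)
  · rintro ⟨G, -, hFG, -⟩
    exact ⟨hF, seriesProd_self_star_eq_zero hF hFG⟩
  · rintro ⟨h₁, h₂⟩
    exact ⟨adjoint F, by rwa [adjoint_adjoint], h₂, h₁⟩
  · rintro ⟨a, ha⟩
    constructor
    · rintro ⟨G, ⟨b, hb⟩, hFG, hGF⟩
      exact exists_eq_add_of_seriesProd_inverse hd hdd ha hb hFG hGF
    · rintro ⟨U, Z, ⟨h₁, h₂⟩, hZ, rfl⟩
      have hZd := mul_eq_zero_of_eq_compl_mul_compl hdd hZ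
      refine ⟨adjoint U - Z, ?_, seriesProd_add_star_sub U hZd h₂,
        seriesProd_star_sub_add U hZd h₁⟩
      refine exists_seriesProd_star_sub_le (u := star U) hd hdd ?_ hZ
      rw [star_star]
      exact h₂
  · refine ⟨fun ⟨h₁, h⟩ => ⟨⟨h₁, ?_⟩, h⟩, fun ⟨⟨h₁, _⟩, h⟩ => ⟨h₁, h⟩⟩
    rwa [(hz h _).1, add_comm, ← (hz h _).2]
  · constructor
    · rintro ⟨h₁, h⟩
      have hb : HasBlock F (Complex.I • (-Complex.I • (prH H K ∘L F ∘L inH H K))) 0 0 0 := by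
        simpa [smul_smul] using hasBlock_of_eq_compl_mul_compl h
      refine ⟨_, hb.adjoint_add_eq_zero_iff.mp ?_, hb⟩
      rwa [← (hz h _).2]
    · rintro ⟨T, hT, hb⟩
      have h := hb.eq_compl_mul_compl
      exact ⟨(hz h _).2.trans (hb.adjoint_add_eq_zero_iff.mpr hT), h⟩

end QS
end
end

section
/- For every F ∈ B(𝔥⊕𝔎), the following operator identity holds: (ΔF + I)* (F ⋄ F*) (ΔF + I) = F* ⋄ F + (F* ⋄ F) Δ (F* ⋄ F). -/
noncomputable section

open ContinuousLinearMap

namespace QS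

variable (H K : Type*) [NormedAddCommGroup H] [InnerProductSpace ℂ H] [CompleteSpace H]
  [NormedAddCommGroup K] [InnerProductSpace ℂ K] [CompleteSpace K]

variable {H K}

/-- Wills' identity:
`(ΔF + I)* (F ⋄ F*) (ΔF + I) = F* ⋄ F + (F* ⋄ F) Δ (F* ⋄ F)`. -/
theorem wills_identity (F : E H K →L[ℂ] E H K) :
    adjoint (Dl H K * F + 1) * sp F (adjoint F) * (Dl H K * F + 1) =
      sp (adjoint F) F + sp (adjoint F) F * Dl H K * sp (adjoint F) F := by
  have h : adjoint (Dl H K * F + 1) = adjoint F * Dl H K + 1 := by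
    simp only [← star_eq_adjoint, star_add, star_mul, star_one]
    rw [star_eq_adjoint (Dl H K), adjoint_Dl]
  rw [h]
  simp only [sp]
  noncomm_ring

end QS
end
end

section
/- Let β ∈ ℝ and let F ∈ B(𝔥⊕𝔎) have block matrix form [K, M; L, N]. The following are equivalent: (i) F* ⋄ F ≤ 2βΔ⊥; (ii) there exist a selfadjoint H ∈ B(𝔥), a nonnegative A ∈ B(𝔥), a contraction C ∈ B(𝔎) and a contraction D ∈ B(𝔎;𝔥) such that K = βI + iH − ½(L*L + A²), M = −L*C − AD(I − C*C)^{1/2} and N = C − I; (iii) there exist a selfadjoint H ∈ B(𝔥), a nonnegative B ∈ B(𝔥), a contraction C ∈ B(𝔎) and a contraction E ∈ B(𝔎;𝔥) such that K = βI + iH − ½(MM* + B²), L = −CM* − (I − CC*)^{1/2}E*B and N = C − I; (iv) F ⋄ F* ≤ 2βΔ⊥. -/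
noncomputable section

open ContinuousLinearMap

namespace QS

variable (H K : Type*) [NormedAddCommGroup H] [InnerProductSpace ℂ H] [CompleteSpace H]
  [NormedAddCommGroup K] [InnerProductSpace ℂ K] [CompleteSpace K]

variable {H K}

theorem exists_contraction_factor {X Y Z : Type*} [NormedAddCommGroup X] [InnerProductSpace ℂ X]
    [NormedAddCommGroup Y] [InnerProductSpace ℂ Y] [CompleteSpace Y]
    [NormedAddCommGroup Z] [InnerProductSpace ℂ Z] [CompleteSpace Z]
    (A : X →L[ℂ] Y) (B : X →L[ℂ] Z) (h : ∀ x, ‖B x‖ ≤ ‖A x‖) :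
    ∃ W : Y →L[ℂ] Z, ‖W‖ ≤ 1 ∧ B = W ∘L A := by
  let U : Submodule ℂ Y := A.range.topologicalClosure
  have hU : CompleteSpace U :=
    A.range.isClosed_topologicalClosure.completeSpace_coe
  let e : X →ₗ[ℂ] U := A.toLinearMap.codRestrict U
    fun x => A.range.le_topologicalClosure ⟨x, rfl⟩
  have hd : DenseRange e := by
    intro y
    rw [closure_subtype]
    refine closure_mono ?_ y.2
    rintro _ ⟨x, rfl⟩
    exact ⟨e x, ⟨x, rfl⟩, rfl⟩
  have hn : ∀ x, ‖B.toLinearMap x‖ ≤ 1 * ‖e x‖ := fun x => by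
    rw [one_mul]; exact h x
  refine ⟨(B.toLinearMap.extendOfNorm e) ∘L U.orthogonalProjectionOnto, ?_, ?_⟩
  · refine (opNorm_comp_le _ _).trans (mul_le_one₀ ?_ (norm_nonneg _) ?_)
    · exact LinearMap.opNorm_extendOfNorm_le hd zero_le_one hn
    · exact U.orthogonalProjectionOnto_norm_le
  · ext x
    have : U.orthogonalProjectionOnto (A x) = e x :=
      U.orthogonalProjectionOnto_mem_subspace_eq_self (e x)
    simp only [comp_apply, this]
    exact (LinearMap.extendOfNorm_eq hd ⟨1, hn⟩ x).symm

theorem HasBlock.adjoint {F : E H K →L[ℂ] E H K}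
    {Kc : H →L[ℂ] H} {M : K →L[ℂ] H} {L : H →L[ℂ] K} {N : K →L[ℂ] K}
    (hF : HasBlock F Kc M L N) :
    HasBlock (adjoint F) (adjoint Kc) (adjoint L) (adjoint M) (adjoint N) := by
  intro u ζ
  refine ext_inner_right ℂ fun y => ?_
  obtain ⟨⟨u', ζ'⟩⟩ := y
  have h := hF u' ζ'
  simp only [WithLp.equiv_symm_apply] at h ⊢
  rw [adjoint_inner_left, h]
  simp [WithLp.prod_inner_apply, adjoint_inner_left, inner_add_left, inner_add_right]
  ring

theorem inner_gap {F : E H K →L[ℂ] E H K}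
    {Kc : H →L[ℂ] H} {M : K →L[ℂ] H} {L : H →L[ℂ] K} {N : K →L[ℂ] K}
    (hF : HasBlock F Kc M L N) (β : ℝ) (u u' : H) (ζ ζ' : K) :
    inner ℂ ((((2 * β : ℝ) : ℂ) • Dp H K - sp (adjoint F) F) (WithLp.toLp 2 (u, ζ)))
      (WithLp.toLp 2 (u', ζ') : E H K) =
    (2 * β : ℝ) * inner ℂ u u' - (inner ℂ u (Kc u' + M ζ') + inner ℂ ζ (L u' + N ζ')
      + inner ℂ (L u + N ζ) (L u' + N ζ')
      + inner ℂ (Kc u + M ζ) u' + inner ℂ (L u + N ζ) ζ') := by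
  have h := hF u ζ
  have h' := hF u' ζ'
  simp only [WithLp.equiv_symm_apply] at h h'
  have hl : ∀ (a : H) (b : K), Dl H K (WithLp.toLp 2 (a, b)) = WithLp.toLp 2 (0, b) :=
    fun a b => rfl
  have hs : (((2 * β : ℝ) : ℂ) • Dp H K - sp (ContinuousLinearMap.adjoint F) F)
      (WithLp.toLp 2 (u, ζ)) = ((2 * β : ℝ) : ℂ) • WithLp.toLp 2 (u, 0) -
        (ContinuousLinearMap.adjoint F (WithLp.toLp 2 (u, ζ)) + ContinuousLinearMap.adjoint F
          (Dl H K (F (WithLp.toLp 2 (u, ζ)))) + F (WithLp.toLp 2 (u, ζ))) := by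
    have : Dp H K (WithLp.toLp 2 (u, ζ)) = WithLp.toLp 2 (u, 0) := by
      simp [Dp, hl, ← WithLp.toLp_sub]
    rw [← this]
    rfl
  rw [hs]
  simp only [inner_sub_left, inner_add_left, adjoint_inner_left, h, h', hl, inner_smul_left,
    Complex.conj_ofReal]
  simp [WithLp.prod_inner_apply, inner_add_left, inner_add_right]
  ring

theorem opLe_sp_iff {F : E H K →L[ℂ] E H K}
    {Kc : H →L[ℂ] H} {M : K →L[ℂ] H} {L : H →L[ℂ] K} {N : K →L[ℂ] K}
    (hF : HasBlock F Kc M L N) (β : ℝ) :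
    opLe (sp (adjoint F) F) (((2 * β : ℝ) : ℂ) • Dp H K) ↔
      ∀ (u : H) (ζ : K), 2 * (inner ℂ u (Kc u + M ζ)).re + 2 * (inner ℂ ζ (L u + N ζ)).re
        + ‖L u + N ζ‖ ^ 2 ≤ 2 * β * ‖u‖ ^ 2 := by
  have key : ∀ (u : H) (ζ : K),
      inner ℂ ((((2 * β : ℝ) : ℂ) • Dp H K - sp (adjoint F) F) (WithLp.toLp 2 (u, ζ)))
        (WithLp.toLp 2 (u, ζ) : E H K) =
      ((2 * β * ‖u‖ ^ 2 - (2 * (inner ℂ u (Kc u + M ζ)).re + 2 * (inner ℂ ζ (L u + N ζ)).re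
        + ‖L u + N ζ‖ ^ 2) : ℝ) : ℂ) := by
    intro u ζ
    rw [inner_gap hF]
    generalize Kc u + M ζ = p
    generalize L u + N ζ = q
    rw [inner_self_eq_norm_sq_to_K, inner_self_eq_norm_sq_to_K, ← inner_conj_symm p,
      ← inner_conj_symm q ζ]
    apply Complex.ext <;> simp [← Complex.ofReal_pow, -inner_conj_symm] <;> ring
  rw [opLe, isPositive_iff_complex]
  refine ⟨fun h u ζ => ?_, fun h x => ?_⟩
  · have := (h (WithLp.toLp 2 (u, ζ))).2
    rw [key] at this
    simp only [RCLike.re_to_complex, Complex.ofReal_re] at this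
    linarith
  · obtain ⟨⟨u, ζ⟩⟩ := x
    rw [key]
    refine ⟨rfl, ?_⟩
    simp only [RCLike.re_to_complex, Complex.ofReal_re]
    linarith [h u ζ]

theorem exists_isPositive_mul_self_eq_adjoint_comp {X : Type*} [NormedAddCommGroup X] [InnerProductSpace ℂ X]
    [CompleteSpace X] {Y : Type*} [NormedAddCommGroup Y] [InnerProductSpace ℂ Y]
    [CompleteSpace Y] (G : X →L[ℂ] Y) :
    ∃ A : X →L[ℂ] X, A.IsPositive ∧ A * A = adjoint G ∘L G ∧ ∀ x, ‖G x‖ ≤ ‖A x‖ := by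
  have hP : 0 ≤ adjoint G ∘L G := (nonneg_iff_isPositive _).2 (isPositive_adjoint_comp_self G)
  have hA : (CFC.sqrt (adjoint G ∘L G)).IsPositive :=
    (nonneg_iff_isPositive _).1 (CFC.sqrt_nonneg _)
  have hm := CFC.sqrt_mul_sqrt_self _ hP
  refine ⟨_, hA, hm, fun x => ?_⟩
  have h : inner ℂ (G x) (G x) = inner ℂ (CFC.sqrt (adjoint G ∘L G) x)
      (CFC.sqrt (adjoint G ∘L G) x) := by
    have hx : CFC.sqrt (adjoint G ∘L G) (CFC.sqrt (adjoint G ∘L G) x) = adjoint G (G x) :=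
      DFunLike.congr_fun hm x
    rw [hA.inner_left_eq_inner_right, hx, adjoint_inner_right]
  rw [inner_self_eq_norm_sq_to_K, inner_self_eq_norm_sq_to_K] at h
  norm_cast at h
  exact ((sq_eq_sq₀ (norm_nonneg _) (norm_nonneg _)).1 h).le

/-- The block matrix form of a `β`-quasicontractive generator. -/
def IsQCBlock (β : ℝ) (Kc : H →L[ℂ] H) (M : K →L[ℂ] H) (L : H →L[ℂ] K) (N : K →L[ℂ] K) : Prop :=
  ∃ (Hs A : H →L[ℂ] H) (C : K →L[ℂ] K) (D : K →L[ℂ] H) (S : K →L[ℂ] K),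
    IsSelfAdjoint Hs ∧ A.IsPositive ∧ ‖C‖ ≤ 1 ∧ ‖D‖ ≤ 1 ∧
    S.IsPositive ∧ S * S = 1 - adjoint C * C ∧
    Kc = (β : ℂ) • 1 + Complex.I • Hs - (2⁻¹ : ℂ) • (adjoint L ∘L L + A * A) ∧
    M = -(adjoint L ∘L C) - A ∘L D ∘L S ∧
    N = C - 1

theorem isQCBlock_of_opLe {F : E H K →L[ℂ] E H K}
    {Kc : H →L[ℂ] H} {M : K →L[ℂ] H} {L : H →L[ℂ] K} {N : K →L[ℂ] K}
    (hF : HasBlock F Kc M L N) {β : ℝ}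
    (h : opLe (sp (adjoint F) F) (((2 * β : ℝ) : ℂ) • Dp H K)) : IsQCBlock β Kc M L N := by
  have hgap := inner_gap hF β
  rw [opLe] at h
  set Z := ((2 * β : ℝ) : ℂ) • Dp H K - sp (adjoint F) F
  obtain ⟨G, hG⟩ : ∃ G : E H K →L[ℂ] E H K, ∀ x y, inner ℂ (Z x) y = inner ℂ (G x) (G y) := by
    have hG : (CFC.sqrt Z).IsPositive := (nonneg_iff_isPositive _).1 (CFC.sqrt_nonneg _)
    refine ⟨CFC.sqrt Z, fun x y => ?_⟩
    rw [← hG.inner_left_eq_inner_right]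
    congr 1
    exact (DFunLike.congr_fun (CFC.sqrt_mul_sqrt_self Z ((nonneg_iff_isPositive _).2 h)) x).symm
  have hGH : ∀ u u', inner ℂ ((G ∘L inH H K) u) ((G ∘L inH H K) u') =
      (2 * β : ℝ) * inner ℂ u u' - (inner ℂ u (Kc u') + inner ℂ (L u) (L u')
        + inner ℂ (Kc u) u') := fun u u' => by
    refine (hG (inH H K u) (inH H K u')).symm.trans ((hgap u u' 0 0).trans ?_)
    simp
  have hGM : ∀ u ζ, inner ℂ ((G ∘L inH H K) u) ((G ∘L inK H K) ζ) =
      -(inner ℂ u (M ζ) + inner ℂ (L u) (N ζ) + inner ℂ (L u) ζ) := fun u ζ => by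
    refine (hG (inH H K u) (inK H K ζ)).symm.trans ((hgap u 0 0 ζ).trans ?_)
    simp
  have hGK : ∀ ζ ζ', inner ℂ ((G ∘L inK H K) ζ) ((G ∘L inK H K) ζ') =
      -(inner ℂ ζ (N ζ') + inner ℂ (N ζ) (N ζ') + inner ℂ (N ζ) ζ') := fun ζ ζ' => by
    refine (hG (inK H K ζ) (inK H K ζ')).symm.trans ((hgap 0 0 ζ ζ').trans ?_)
    simp
  generalize G ∘L inH H K = G₁ at hGH hGM
  generalize G ∘L inK H K = G₂ at hGM hGK
  obtain ⟨A, hA, hAA, hA'⟩ := exists_isPositive_mul_self_eq_adjoint_comp G₁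
  obtain ⟨S, hS, hSS, hS'⟩ := exists_isPositive_mul_self_eq_adjoint_comp G₂
  obtain ⟨W₁, hW₁, hGW₁⟩ := exists_contraction_factor A G₁ hA'
  obtain ⟨W₂, hW₂, hGW₂⟩ := exists_contraction_factor S G₂ hS'
  have hAA' : A * A = ((2 * β : ℝ) : ℂ) • 1 - (Kc + adjoint L ∘L L + adjoint Kc) := by
    rw [hAA]
    ext u
    refine ext_inner_left ℂ fun u' => ?_
    simp [adjoint_inner_right, hGH, inner_sub_right, inner_add_right, inner_smul_right]
  have hSS' : S * S = 1 - adjoint (N + 1) * (N + 1) := by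
    rw [hSS]
    ext ζ
    refine ext_inner_left ℂ fun ζ' => ?_
    simp [adjoint_inner_right, hGK, inner_sub_right, inner_add_right]
    ring
  refine ⟨(-(Complex.I / 2)) • (Kc - adjoint Kc), A, N + 1, adjoint W₁ ∘L W₂, S, ?_, hA, ?_, ?_,
    hS, hSS', ?_, ?_, ?_⟩
  · rw [IsSelfAdjoint, star_smul, star_sub, ← star_eq_adjoint, star_star]
    simp
    module
  · refine opNorm_le_bound _ zero_le_one fun ζ => ?_
    have h1 : ((‖(N + 1) ζ‖ ^ 2 : ℝ) : ℂ) = ((‖ζ‖ ^ 2 - ‖G₂ ζ‖ ^ 2 : ℝ) : ℂ) := by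
      have := hGK ζ ζ
      have h2 : inner ℂ ((N + 1) ζ) ((N + 1) ζ) = inner ℂ ζ ζ - inner ℂ (G₂ ζ) (G₂ ζ) := by
        rw [this]
        simp only [add_apply, one_apply_eq_self, inner_add_left, inner_add_right]
        ring
      simp only [inner_self_eq_norm_sq_to_K] at h2
      push_cast
      exact h2
    have h2 := Complex.ofReal_injective h1
    rw [one_mul]
    exact abs_le_of_sq_le_sq' (by nlinarith [sq_nonneg ‖G₂ ζ‖]) (norm_nonneg _) |>.2
  · refine (opNorm_comp_le _ _).trans (mul_le_one₀ ?_ (norm_nonneg _) hW₂)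
    rwa [LinearIsometryEquiv.norm_map]
  · rw [hAA', smul_sub (-(Complex.I / 2))]
    simp only [smul_smul, smul_sub, smul_add]
    have : Complex.I * (-(Complex.I / 2)) = 2⁻¹ := by
      rw [mul_neg, ← mul_div_assoc, Complex.I_mul_I]; norm_num
    rw [this]
    push_cast
    module
  · ext ζ
    refine ext_inner_left ℂ fun u => ?_
    have h1 := hGM u ζ
    have h2 : inner ℂ (G₁ u) (G₂ ζ) = inner ℂ u (A (adjoint W₁ (W₂ (S ζ)))) := by
      rw [hGW₁, hGW₂, ← hA.inner_left_eq_inner_right, adjoint_inner_right]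
      rfl
    simp only [sub_apply, neg_apply, comp_apply, inner_sub_right, inner_neg_right, ← h2, h1,
      adjoint_inner_right, add_apply, inner_add_right]
    simp
  · simp

theorem IsQCBlock.opLe_and_opLe {F : E H K →L[ℂ] E H K}
    {Kc : H →L[ℂ] H} {M : K →L[ℂ] H} {L : H →L[ℂ] K} {N : K →L[ℂ] K}
    (hF : HasBlock F Kc M L N) {β : ℝ} (h : IsQCBlock β Kc M L N) :
    opLe (sp (adjoint F) F) (((2 * β : ℝ) : ℂ) • Dp H K) ∧
      opLe (sp F (adjoint F)) (((2 * β : ℝ) : ℂ) • Dp H K) := by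
  have hadj := opLe_sp_iff hF.adjoint β
  rw [adjoint_adjoint] at hadj
  rw [opLe_sp_iff hF, hadj]
  obtain ⟨Hs, A, C, D, S, hHs, hA, hC, hD, hS, hSS, rfl, rfl, rfl⟩ := h
  have hSn : ∀ ζ, ‖S ζ‖ ^ 2 = ‖ζ‖ ^ 2 - ‖C ζ‖ ^ 2 := fun ζ => by
    have h1 : inner ℂ (S ζ) (S ζ) = inner ℂ ζ ζ - inner ℂ (C ζ) (C ζ) := by
      have h2 : S (S ζ) = ζ - adjoint C (C ζ) := DFunLike.congr_fun hSS ζ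
      rw [hS.inner_left_eq_inner_right, h2, inner_sub_right, adjoint_inner_right]
    simp only [inner_self_eq_norm_sq_to_K] at h1
    exact_mod_cast h1
  have hK : ∀ u, (inner ℂ u (((β : ℂ) • (1 : H →L[ℂ] H) + Complex.I • Hs
      - (2⁻¹ : ℂ) • (adjoint L ∘L L + A * A)) u)).re
      = β * ‖u‖ ^ 2 - (‖L u‖ ^ 2 + ‖A u‖ ^ 2) / 2 := fun u => by
    have h1 : (inner ℂ u (Hs u)).im = 0 := by
      have : inner ℂ (Hs u) u = inner ℂ u (Hs u) := hHs.isSymmetric u u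
      rw [← inner_conj_symm] at this
      exact Complex.conj_eq_iff_im.1 this
    have h2 : inner ℂ u (A (A u)) = inner ℂ (A u) (A u) :=
      (hA.inner_left_eq_inner_right _ _).symm
    simp [adjoint_inner_right, h1, h2, ← Complex.ofReal_pow]
    ring
  have hDA : ∀ u, ‖adjoint D (A u)‖ ^ 2 ≤ ‖A u‖ ^ 2 := fun u => by
    refine pow_le_pow_left₀ (norm_nonneg _) ?_ 2
    refine (le_of_opNorm_le _ (?_ : ‖adjoint D‖ ≤ 1) _).trans (one_mul _).le
    rwa [LinearIsometryEquiv.norm_map]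
  refine ⟨fun u ζ => ?_, fun u ζ => ?_⟩
  · have h1 : inner ℂ u ((-(adjoint L ∘L C) - A ∘L D ∘L S) ζ)
        = -inner ℂ (L u) (C ζ) - inner ℂ (adjoint D (A u)) (S ζ) := by
      simp [adjoint_inner_right, adjoint_inner_left,
        hA.inner_left_eq_inner_right]
    rw [inner_add_right, Complex.add_re, hK, h1]
    have h2 := hDA u
    have h3 := hSn ζ
    have h4 := norm_add_sq (𝕜 := ℂ) (adjoint D (A u)) (S ζ)
    have h5 : L u + (C - 1) ζ = (L u + C ζ) - ζ := by simp; abel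
    have h6 := norm_sub_sq (𝕜 := ℂ) (L u + C ζ) ζ
    have h7 := norm_add_sq (𝕜 := ℂ) (L u) (C ζ)
    have h8 : (inner ℂ ζ (L u + C ζ)).re = (inner ℂ (L u + C ζ) ζ).re :=
      inner_re_symm (𝕜 := ℂ) _ _
    have h9 : (inner ℂ ζ ζ).re = ‖ζ‖ ^ 2 := (norm_sq_eq_re_inner (𝕜 := ℂ) ζ).symm
    rw [h5, inner_sub_right]
    simp only [RCLike.re_to_complex, Complex.sub_re, Complex.neg_re] at *
    nlinarith [sq_nonneg ‖adjoint D (A u) + S ζ‖]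
  · set a := adjoint D (A u) with ha
    set w := adjoint C (L u - ζ) + S a with hw
    have h1 : adjoint (-(adjoint L ∘L C) - A ∘L D ∘L S) u + adjoint (C - 1) ζ = -(w + ζ) := by
      have e1 : adjoint (-(adjoint L ∘L C) - A ∘L D ∘L S) u
          = -(adjoint C (L u)) - S a := by
        simp [map_sub, map_neg, adjoint_comp, hA.isSelfAdjoint.adjoint_eq,
          hS.isSelfAdjoint.adjoint_eq, ha]
      have e2 : adjoint (C - 1) ζ = adjoint C ζ - ζ := by
        rw [map_sub, one_def, adjoint_id]; rfl
      rw [e1, e2, hw, map_sub]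
      abel
    have h2 : ‖w‖ ^ 2 ≤ ‖L u - ζ‖ ^ 2 + ‖a‖ ^ 2 := by
      have e1 : ‖w‖ ^ 2 = (inner ℂ (L u - ζ) (C w)).re + (inner ℂ a (S w)).re := by
        rw [norm_sq_eq_re_inner (𝕜 := ℂ) w]
        nth_rw 1 [hw]
        rw [inner_add_left, adjoint_inner_left, hS.inner_left_eq_inner_right]
        rfl
      have e2 : (inner ℂ (L u - ζ) (C w)).re ≤ _ := re_inner_le_norm (𝕜 := ℂ) _ _
      have e3 : (inner ℂ a (S w)).re ≤ _ := re_inner_le_norm (𝕜 := ℂ) _ _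
      nlinarith [hSn w, sq_nonneg (‖L u - ζ‖ - ‖C w‖), sq_nonneg (‖a‖ - ‖S w‖)]
    rw [h1, inner_add_right, Complex.add_re, adjoint_inner_right, adjoint_inner_right,
      norm_neg, inner_neg_right, inner_add_right]
    have h3 := hK u
    have h3' := inner_re_symm (𝕜 := ℂ) (((β : ℂ) • (1 : H →L[ℂ] H) + Complex.I • Hs
      - (2⁻¹ : ℂ) • (adjoint L ∘L L + A * A)) u) u
    have h4 := norm_add_sq (𝕜 := ℂ) w ζ
    have h5 := norm_sub_sq (𝕜 := ℂ) (L u) ζ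
    have h6 : (inner ℂ ζ w).re = (inner ℂ w ζ).re := inner_re_symm (𝕜 := ℂ) _ _
    have h7 : (inner ℂ ζ ζ).re = ‖ζ‖ ^ 2 := (norm_sq_eq_re_inner (𝕜 := ℂ) ζ).symm
    have h8 := hDA u
    simp only [RCLike.re_to_complex, Complex.add_re, Complex.neg_re] at *
    linarith

/-- Characterisation of the `β`-quasicontractive stochastic generators:
`F* ⋄ F ≤ 2βΔ⊥` iff `F` has the block matrix form (★), iff `F` has the block matrix
form (★★), iff `F ⋄ F* ≤ 2βΔ⊥`.  (Square roots are encoded as the unique nonnegative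
operator square roots.) -/
theorem qc_characterisation (β : ℝ) (F : E H K →L[ℂ] E H K)
    (Kc : H →L[ℂ] H) (M : K →L[ℂ] H) (L : H →L[ℂ] K) (N : K →L[ℂ] K)
    (hF : HasBlock F Kc M L N) :
    (opLe (sp (adjoint F) F) (((2 * β : ℝ) : ℂ) • Dp H K) ↔
      ∃ (Hs A : H →L[ℂ] H) (C : K →L[ℂ] K) (D : K →L[ℂ] H) (S : K →L[ℂ] K),
        IsSelfAdjoint Hs ∧ A.IsPositive ∧ ‖C‖ ≤ 1 ∧ ‖D‖ ≤ 1 ∧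
        S.IsPositive ∧ S * S = 1 - adjoint C * C ∧
        Kc = (β : ℂ) • 1 + Complex.I • Hs - (2⁻¹ : ℂ) • (adjoint L ∘L L + A * A) ∧
        M = -(adjoint L ∘L C) - A ∘L D ∘L S ∧
        N = C - 1) ∧
    (opLe (sp (adjoint F) F) (((2 * β : ℝ) : ℂ) • Dp H K) ↔
      ∃ (Hs B : H →L[ℂ] H) (C : K →L[ℂ] K) (Ec : K →L[ℂ] H) (T : K →L[ℂ] K),
        IsSelfAdjoint Hs ∧ B.IsPositive ∧ ‖C‖ ≤ 1 ∧ ‖Ec‖ ≤ 1 ∧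
        T.IsPositive ∧ T * T = 1 - C * adjoint C ∧
        Kc = (β : ℂ) • 1 + Complex.I • Hs - (2⁻¹ : ℂ) • (M ∘L adjoint M + B * B) ∧
        L = -(C ∘L adjoint M) - T ∘L adjoint Ec ∘L B ∧
        N = C - 1) ∧
    (opLe (sp (adjoint F) F) (((2 * β : ℝ) : ℂ) • Dp H K) ↔
      opLe (sp F (adjoint F)) (((2 * β : ℝ) : ℂ) • Dp H K)) := by
  have hF' := hF.adjoint
  have hadj : opLe (sp (adjoint F) F) (((2 * β : ℝ) : ℂ) • Dp H K) ↔
      opLe (sp F (adjoint F)) (((2 * β : ℝ) : ℂ) • Dp H K) := by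
    refine ⟨fun h => ((isQCBlock_of_opLe hF h).opLe_and_opLe hF).2, fun h => ?_⟩
    have h' : opLe (sp (adjoint (adjoint F)) (adjoint F)) (((2 * β : ℝ) : ℂ) • Dp H K) := by
      rwa [adjoint_adjoint]
    simpa using ((isQCBlock_of_opLe hF' h').opLe_and_opLe hF').2
  refine ⟨⟨isQCBlock_of_opLe hF, fun h => (IsQCBlock.opLe_and_opLe hF h).1⟩, ?_, hadj⟩
  rw [hadj]
  have hiff : opLe (sp F (adjoint F)) (((2 * β : ℝ) : ℂ) • Dp H K) ↔
      IsQCBlock β (adjoint Kc) (adjoint L) (adjoint M) (adjoint N) := by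
    refine ⟨fun h => isQCBlock_of_opLe hF' (by rwa [adjoint_adjoint]), fun h => ?_⟩
    simpa using (IsQCBlock.opLe_and_opLe hF' h).1
  rw [hiff]
  constructor
  · rintro ⟨Hs, B, C, D, T, hHs, hB, hC, hD, hT, hTT, hK, hL, hN⟩
    refine ⟨-Hs, B, adjoint C, D, T, hHs.neg, hB, ?_, hD, hT, by simpa using hTT, ?_, ?_, ?_⟩
    · rwa [LinearIsometryEquiv.norm_map]
    · rw [← adjoint_adjoint Kc, hK]
      have hMM : star (M ∘L adjoint M) = M ∘L adjoint M :=
        (isPositive_self_comp_adjoint M).isSelfAdjoint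
      simp [← star_eq_adjoint, hHs.star_eq, hB.isSelfAdjoint.star_eq, hMM]
    · rw [← adjoint_adjoint L, hL]
      simp [adjoint_comp, hB.isSelfAdjoint.adjoint_eq, hT.isSelfAdjoint.adjoint_eq, comp_assoc]
    · rw [← adjoint_adjoint N, hN]
      simp [← star_eq_adjoint]
  · rintro ⟨Hs, B, C, D, T, hHs, hB, hC, hD, hT, hTT, hK, hL, hN⟩
    refine ⟨-Hs, B, adjoint C, D, T, hHs.neg, hB, ?_, hD, hT, by simpa using hTT, ?_, ?_, ?_⟩
    · rwa [LinearIsometryEquiv.norm_map]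
    · rw [hK]
      have hMM : star (M ∘L adjoint M) = M ∘L adjoint M :=
        (isPositive_self_comp_adjoint M).isSelfAdjoint
      simp [← star_eq_adjoint, hHs.star_eq, hB.isSelfAdjoint.star_eq, hMM]
    · rw [hL]
      simp [adjoint_comp, hB.isSelfAdjoint.adjoint_eq, hT.isSelfAdjoint.adjoint_eq, comp_assoc]
    · rw [hN]
      simp [← star_eq_adjoint]

end QS
end
end

section
/- Let 𝔎 = 𝔎₁ ⊕ 𝔎₂ be an orthogonal decomposition of 𝔎, let J₁ : 𝔥⊕𝔎₁ → 𝔥⊕𝔎 be the isometry u⊕ζ ↦ u⊕(ζ⊕0), and let ⋄₁ and Δ₁⊥ denote the series product and the projection complement defined analogously on B(𝔥⊕𝔎₁) (with Δ₁ the orthogonal projection onto {0}⊕𝔎₁). Then for every β ∈ ℝ: {J₁* F J₁ : F ∈ B(𝔥⊕𝔎), F* ⋄ F ≤ 2βΔ⊥} = {F₁ ∈ B(𝔥⊕𝔎₁) : F₁* ⋄₁ F₁ ≤ 2βΔ₁⊥}. -/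
noncomputable section

open ContinuousLinearMap

namespace QS

variable (H K : Type*) [NormedAddCommGroup H] [InnerProductSpace ℂ H] [CompleteSpace H]
  [NormedAddCommGroup K] [InnerProductSpace ℂ K] [CompleteSpace K]

variable {H K}

variable (H K)
variable (K₁ K₂ : Type*) [NormedAddCommGroup K₁] [InnerProductSpace ℂ K₁] [CompleteSpace K₁]
  [NormedAddCommGroup K₂] [InnerProductSpace ℂ K₂] [CompleteSpace K₂]

/-- The Hilbert space orthogonal decomposition `𝔎 = 𝔎₁ ⊕ 𝔎₂`. -/
abbrev Kd := WithLp 2 (K₁ × K₂)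

/-- The isometry `J₁ : 𝔥 ⊕ 𝔎₁ → 𝔥 ⊕ 𝔎`, `u ⊕ ζ ↦ u ⊕ (ζ ⊕ 0)`. -/
def J₁ : E H K₁ →L[ℂ] E H (Kd K₁ K₂) :=
  (((eE H (Kd K₁ K₂)).symm : H × Kd K₁ K₂ →L[ℂ] E H (Kd K₁ K₂))).comp
    ((ContinuousLinearMap.prodMap (ContinuousLinearMap.id ℂ H)
      ((((WithLp.prodContinuousLinearEquiv 2 ℂ K₁ K₂).symm :
          K₁ × K₂ →L[ℂ] Kd K₁ K₂)).comp (ContinuousLinearMap.inl ℂ K₁ K₂))).comp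
      ((eE H K₁ : E H K₁ →L[ℂ] H × K₁)))

section Compression

variable {H K₁ K₂}

omit [CompleteSpace H] [CompleteSpace K₁] in
lemma Dl_apply (x : E H K₁) : Dl H K₁ x = WithLp.toLp 2 (0, x.snd) := rfl

omit [CompleteSpace H] [CompleteSpace K₁] [CompleteSpace K₂] in
lemma J₁_apply (x : E H K₁) :
    J₁ H K₁ K₂ x = WithLp.toLp 2 (x.fst, WithLp.toLp 2 (x.snd, 0)) := rfl

lemma adjoint_J₁_apply (x : E H (Kd K₁ K₂)) :
    adjoint (J₁ H K₁ K₂) x = WithLp.toLp 2 (x.fst, x.snd.fst) := by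
  refine ext_inner_right ℂ fun y => ?_
  rw [adjoint_inner_left, J₁_apply]
  simp [WithLp.prod_inner_apply]

lemma adjoint_J₁_J₁_apply (x : E H K₁) : adjoint (J₁ H K₁ K₂) (J₁ H K₁ K₂ x) = x := by
  rw [adjoint_J₁_apply, J₁_apply]
  rfl

omit [CompleteSpace H] [CompleteSpace K₁] [CompleteSpace K₂] in
lemma Dl_J₁_apply (x : E H K₁) :
    Dl H (Kd K₁ K₂) (J₁ H K₁ K₂ x) = J₁ H K₁ K₂ (Dl H K₁ x) := rfl

lemma adjoint_J₁_Dp_J₁ :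
    adjoint (J₁ H K₁ K₂) ∘L Dp H (Kd K₁ K₂) ∘L J₁ H K₁ K₂ = Dp H K₁ := by
  ext1 x
  simp [Dp, Dl_J₁_apply, adjoint_J₁_J₁_apply]

lemma J₁_Dp_adjoint_J₁ :
    J₁ H K₁ K₂ ∘L Dp H K₁ ∘L adjoint (J₁ H K₁ K₂) = Dp H (Kd K₁ K₂) := by
  ext1 x
  apply WithLp.ofLp_injective 2
  ext1
  · simp [Dp, Dl_apply, J₁_apply, adjoint_J₁_apply]
  · apply WithLp.ofLp_injective 2
    ext1 <;> simp [Dp, Dl_apply, J₁_apply, adjoint_J₁_apply]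

lemma isPositive_Dl_sub_J₁_Dl_adjoint_J₁ :
    (Dl H (Kd K₁ K₂) - J₁ H K₁ K₂ ∘L Dl H K₁ ∘L adjoint (J₁ H K₁ K₂)).IsPositive := by
  refine (isPositive_iff_complex _).2 fun x => ?_
  have h : (Dl H (Kd K₁ K₂) - J₁ H K₁ K₂ ∘L Dl H K₁ ∘L adjoint (J₁ H K₁ K₂)) x =
      WithLp.toLp 2 (0, WithLp.toLp 2 (0, x.snd.snd)) := by
    apply WithLp.ofLp_injective 2
    ext1
    · simp [Dl_apply, J₁_apply, adjoint_J₁_apply]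
    · apply WithLp.ofLp_injective 2
      ext1 <;> simp [Dl_apply, J₁_apply, adjoint_J₁_apply]
  rw [h]
  simp only [WithLp.prod_inner_apply, inner_zero_left, zero_add]
  change _ = inner ℂ x.snd.snd x.snd.snd ∧ 0 ≤ RCLike.re (inner ℂ x.snd.snd x.snd.snd)
  exact ⟨inner_self_ofReal_re _, inner_self_nonneg⟩

lemma sub_sp_compression (c : ℂ) (F : E H (Kd K₁ K₂) →L[ℂ] E H (Kd K₁ K₂)) :
    c • Dp H K₁ - sp (adjoint (adjoint (J₁ H K₁ K₂) ∘L F ∘L J₁ H K₁ K₂))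
        (adjoint (J₁ H K₁ K₂) ∘L F ∘L J₁ H K₁ K₂) =
      adjoint (J₁ H K₁ K₂) ∘L (c • Dp H (Kd K₁ K₂) - sp (adjoint F) F) ∘L J₁ H K₁ K₂ +
        adjoint (F ∘L J₁ H K₁ K₂) ∘L
          (Dl H (Kd K₁ K₂) - J₁ H K₁ K₂ ∘L Dl H K₁ ∘L adjoint (J₁ H K₁ K₂)) ∘L
            (F ∘L J₁ H K₁ K₂) := by
  rw [← adjoint_J₁_Dp_J₁ (K₂ := K₂)]
  ext1 x
  simp only [sp, adjoint_comp, adjoint_adjoint, mul_def, comp_apply, add_apply, sub_apply,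
    smul_apply, map_add, map_sub, map_smul]
  abel

lemma sub_sp_dilation (c : ℂ) (F : E H K₁ →L[ℂ] E H K₁) :
    c • Dp H (Kd K₁ K₂) - sp (adjoint (J₁ H K₁ K₂ ∘L F ∘L adjoint (J₁ H K₁ K₂)))
        (J₁ H K₁ K₂ ∘L F ∘L adjoint (J₁ H K₁ K₂)) =
      J₁ H K₁ K₂ ∘L (c • Dp H K₁ - sp (adjoint F) F) ∘L adjoint (J₁ H K₁ K₂) := by
  rw [← J₁_Dp_adjoint_J₁]
  ext1 x
  simp only [sp, adjoint_comp, adjoint_adjoint, mul_def, comp_apply, add_apply, sub_apply,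
    smul_apply, map_add, map_sub, map_smul, Dl_J₁_apply, adjoint_J₁_J₁_apply]

end Compression

/-- Compression by `J₁` maps the `β`-quasicontractive generators on
`𝔥 ⊕ 𝔎` exactly onto the `β`-quasicontractive generators on `𝔥 ⊕ 𝔎₁`. -/
theorem compression_of_qc_generators (β : ℝ) :
    {G : E H K₁ →L[ℂ] E H K₁ |
        ∃ F : E H (Kd K₁ K₂) →L[ℂ] E H (Kd K₁ K₂),
          opLe (sp (adjoint F) F) (((2 * β : ℝ) : ℂ) • Dp H (Kd K₁ K₂)) ∧
          G = adjoint (J₁ H K₁ K₂) ∘L F ∘L J₁ H K₁ K₂} =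
      {F₁ : E H K₁ →L[ℂ] E H K₁ |
        opLe (sp (adjoint F₁) F₁) (((2 * β : ℝ) : ℂ) • Dp H K₁)} := by
  ext G
  constructor
  · rintro ⟨F, hF, rfl⟩
    change (_ - _ : E H K₁ →L[ℂ] E H K₁).IsPositive
    rw [sub_sp_compression]
    exact (IsPositive.adjoint_conj hF _).add
      (isPositive_Dl_sub_J₁_Dl_adjoint_J₁.adjoint_conj _)
  · intro hG
    refine ⟨J₁ H K₁ K₂ ∘L G ∘L adjoint (J₁ H K₁ K₂), ?_, ?_⟩
    · rw [opLe, sub_sp_dilation]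
      exact IsPositive.conj_adjoint hG _
    · ext1 x
      simp only [comp_apply, adjoint_J₁_J₁_apply]

end QS
end
end

section
/- Set 𝔎' := 𝔎 ⊕ 𝔎 ⊕ 𝔥, let J : 𝔥⊕𝔎 → 𝔥⊕𝔎' be the isometric inclusion u⊕ζ ↦ u⊕(ζ⊕0⊕0), and let ⋄' denote the series product on B(𝔥⊕𝔎') defined via the orthogonal projection Δ' onto {0}⊕𝔎'. Then {F ∈ B(𝔥⊕𝔎) : F* ⋄ F ≤ 0} = {J* F' J : F' ∈ B(𝔥⊕𝔎'), F'* ⋄' F' = 0 = F' ⋄' F'*}; in particular, every F ∈ B(𝔥⊕𝔎) with F* ⋄ F ≤ 0 is the compression by J of some F' ∈ B(𝔥⊕𝔎') with F'* ⋄' F' = 0 = F' ⋄' F'*. -/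
noncomputable section

open ContinuousLinearMap

namespace QS

variable (H K : Type*) [NormedAddCommGroup H] [InnerProductSpace ℂ H] [CompleteSpace H]
  [NormedAddCommGroup K] [InnerProductSpace ℂ K] [CompleteSpace K]

variable {H K}

variable (H K)

/-- `𝔎' := 𝔎 ⊕ (𝔎 ⊕ 𝔥)`. -/
abbrev K' := WithLp 2 (K × WithLp 2 (K × H))

/-- The isometric inclusion `J : 𝔥 ⊕ 𝔎 → 𝔥 ⊕ 𝔎'`, `u ⊕ ζ ↦ u ⊕ (ζ ⊕ 0 ⊕ 0)`. -/
def J : E H K →L[ℂ] E H (K' H K) :=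
  (((eE H (K' H K)).symm : H × K' H K →L[ℂ] E H (K' H K))).comp
    ((ContinuousLinearMap.prodMap (ContinuousLinearMap.id ℂ H)
      ((((WithLp.prodContinuousLinearEquiv 2 ℂ K (WithLp 2 (K × H))).symm :
          K × WithLp 2 (K × H) →L[ℂ] K' H K)).comp
        (ContinuousLinearMap.inl ℂ K (WithLp 2 (K × H))))).comp
      ((eE H K : E H K →L[ℂ] H × K)))

section Blocks

set_option linter.unusedSectionVars false

variable {H K}

lemma re_inner_self (u : H) : (inner ℂ u u).re = ‖u‖ ^ 2 :=
  inner_self_eq_norm_sq (𝕜 := ℂ) u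

lemma E_inner (x y : E H K) : inner ℂ x y = inner ℂ x.fst y.fst + inner ℂ x.snd y.snd := rfl

lemma E_norm_sq (x : E H K) : ‖x‖ ^ 2 = ‖x.fst‖ ^ 2 + ‖x.snd‖ ^ 2 :=
  WithLp.prod_norm_sq_eq_of_L2 x

lemma E_ext {x y : E H K} (h₁ : x.fst = y.fst) (h₂ : x.snd = y.snd) : x = y :=
  WithLp.ofLp_injective 2 (Prod.ext h₁ h₂)

@[simp] lemma inH_fst (u : H) : (inH H K u).fst = u := rfl
@[simp] lemma inH_snd (u : H) : (inH H K u).snd = 0 := rfl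
@[simp] lemma inK_fst (k : K) : (inK H K k).fst = 0 := rfl
@[simp] lemma inK_snd (k : K) : (inK H K k).snd = k := rfl
@[simp] lemma prH_apply (x : E H K) : prH H K x = x.fst := rfl
@[simp] lemma prK_apply (x : E H K) : prK H K x = x.snd := rfl
@[simp] lemma Dl_fst (x : E H K) : (Dl H K x).fst = 0 := rfl
@[simp] lemma Dl_snd (x : E H K) : (Dl H K x).snd = x.snd := rfl

@[simp] lemma blockOf_fst (a : H →L[ℂ] H) (b : K →L[ℂ] H) (c : H →L[ℂ] K) (d : K →L[ℂ] K)
    (x : E H K) : (blockOf a b c d x).fst = a x.fst + b x.snd := by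
  simp [blockOf]

@[simp] lemma blockOf_snd (a : H →L[ℂ] H) (b : K →L[ℂ] H) (c : H →L[ℂ] K) (d : K →L[ℂ] K)
    (x : E H K) : (blockOf a b c d x).snd = c x.fst + d x.snd := by
  simp [blockOf]

lemma adjoint_blockOf (a : H →L[ℂ] H) (b : K →L[ℂ] H) (c : H →L[ℂ] K) (d : K →L[ℂ] K) :
    adjoint (blockOf a b c d) = blockOf (adjoint a) (adjoint c) (adjoint b) (adjoint d) := by
  symm
  rw [eq_adjoint_iff]
  intro x y
  simp only [E_inner, blockOf_fst, blockOf_snd, inner_add_left, inner_add_right,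
    adjoint_inner_left]
  ring

lemma blockOf_mul_blockOf (a a' : H →L[ℂ] H) (b b' : K →L[ℂ] H) (c c' : H →L[ℂ] K)
    (d d' : K →L[ℂ] K) :
    blockOf a b c d * blockOf a' b' c' d' =
      blockOf (a ∘L a' + b ∘L c') (a ∘L b' + b ∘L d') (c ∘L a' + d ∘L c')
        (c ∘L b' + d ∘L d') :=
  ContinuousLinearMap.ext fun x => E_ext (by simp; abel) (by simp; abel)

lemma blockOf_diag_nonneg {a : H →L[ℂ] H} {d : K →L[ℂ] K} (ha : 0 ≤ a) (hd : 0 ≤ d) :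
    0 ≤ blockOf a 0 0 d := by
  rw [nonneg_iff_isPositive] at *
  refine ⟨fun x y => ?_, fun x => ?_⟩
  · simp [ha.inner_left_eq_inner_right, hd.inner_left_eq_inner_right]
  · simpa [reApplyInnerSelf_apply] using
      add_nonneg (ha.re_inner_nonneg_left x.fst) (hd.re_inner_nonneg_left x.snd)

lemma adjoint_prH : adjoint (prH H K) = inH H K := by
  symm
  rw [eq_adjoint_iff]
  intro x y
  simp

lemma adjoint_inH : adjoint (inH H K) = prH H K := by
  rw [← adjoint_prH, adjoint_adjoint]

/-- The quadratic form of `F* ⋄ F`. -/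
def spForm (F : E H K →L[ℂ] E H K) (v : E H K) : ℝ :=
  2 * (inner ℂ (F v) v).re + ‖(F v).snd‖ ^ 2

lemma inner_sp_adjoint (F : E H K →L[ℂ] E H K) (v : E H K) :
    inner ℂ (sp (adjoint F) F v) v = (spForm F v : ℂ) := by
  have h₁ : inner ℂ (Dl H K (F v)) (F v) = ((‖(F v).snd‖ ^ 2 : ℝ) : ℂ) := by
    rw [E_inner, Dl_fst, Dl_snd, inner_zero_left, zero_add, inner_self_eq_norm_sq_to_K]
    norm_cast
  have h₂ : inner ℂ v (F v) + inner ℂ (F v) v = ((2 * (inner ℂ (F v) v).re : ℝ) : ℂ) := by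
    rw [← inner_conj_symm v (F v), add_comm, Complex.add_conj]
  simp only [sp, add_apply, mul_apply_eq_comp, inner_add_left, adjoint_inner_left, h₁]
  rw [add_right_comm, h₂, spForm]
  norm_cast

lemma sp_adjoint_eq_zero_iff (F : E H K →L[ℂ] E H K) :
    sp (adjoint F) F = 0 ↔ ∀ v, spForm F v = 0 := by
  constructor
  · intro h v
    have := inner_sp_adjoint F v
    rw [h] at this
    rw [zero_apply, inner_zero_left] at this
    exact_mod_cast this.symm
  · intro h
    have := (inner_map_self_eq_zero (sp (adjoint F) F : E H K →ₗ[ℂ] E H K)).1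
      fun v => by simpa [h] using inner_sp_adjoint F v
    exact ContinuousLinearMap.coe_injective this

lemma opLe_sp_adjoint_zero_iff (F : E H K →L[ℂ] E H K) :
    opLe (sp (adjoint F) F) 0 ↔ ∀ v, spForm F v ≤ 0 := by
  rw [opLe, isPositive_iff_complex]
  simp only [zero_sub, neg_apply, inner_neg_left, inner_sp_adjoint]
  simp

lemma sp_eq_zero_of_isometry {k : H →L[ℂ] H} {l : H →L[ℂ] K} {U : K →L[ℂ] K}
    (hU : ∀ x, ‖U x‖ = ‖x‖) (hk : ∀ u, 2 * (inner ℂ (k u) u).re + ‖l u‖ ^ 2 = 0) :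
    sp (adjoint (blockOf k (-(adjoint l ∘L U)) l (U - 1))) (blockOf k (-(adjoint l ∘L U)) l (U - 1))
      = 0 := by
  rw [sp_adjoint_eq_zero_iff]
  intro v
  have hk := hk v.fst
  have hU := congrArg (· ^ 2) (hU v.snd)
  simp only [spForm, E_inner, blockOf_fst, blockOf_snd]
  simp only [← re_inner_self, inner_add_left, inner_add_right, inner_sub_left, inner_sub_right,
    inner_neg_left, coe_comp, Function.comp_apply, neg_apply, sub_apply, one_apply_eq_self,
    adjoint_inner_left, Complex.add_re, Complex.sub_re, Complex.neg_re] at hU hk ⊢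
  have c (x y : K) : (inner ℂ x y).re = (inner ℂ y x).re := inner_re_symm (𝕜 := ℂ) x y
  rw [c (U v.snd) (l v.fst), c v.snd (l v.fst), c v.snd (U v.snd)]
  linarith

lemma sp_eq_zero_of_unitary {k : H →L[ℂ] H} {l : H →L[ℂ] K} {U : K →L[ℂ] K}
    (hU : adjoint U ∘L U = 1) (hU' : U ∘L adjoint U = 1)
    (hk : ∀ u, 2 * (inner ℂ (k u) u).re + ‖l u‖ ^ 2 = 0) :
    sp (adjoint (blockOf k (-(adjoint l ∘L U)) l (U - 1))) (blockOf k (-(adjoint l ∘L U)) l (U - 1))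
      = 0 ∧
    sp (blockOf k (-(adjoint l ∘L U)) l (U - 1)) (adjoint (blockOf k (-(adjoint l ∘L U)) l (U - 1)))
      = 0 := by
  have hn : ∀ x, ‖U x‖ = ‖x‖ := (norm_map_iff_adjoint_comp_self U).2 hU
  have hn' : ∀ x, ‖adjoint U x‖ = ‖x‖ :=
    (norm_map_iff_adjoint_comp_self _).2 (by rwa [adjoint_adjoint])
  refine ⟨sp_eq_zero_of_isometry hn hk, ?_⟩
  have key := sp_eq_zero_of_isometry (k := adjoint k) (l := -(adjoint U ∘L l)) hn' fun u => by
    rw [← hk u, adjoint_inner_left, neg_apply, norm_neg, coe_comp, Function.comp_apply, hn',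
      ← inner_conj_symm, Complex.conj_re]
  have e : blockOf (adjoint k) (-(adjoint (-(adjoint U ∘L l)) ∘L adjoint U)) (-(adjoint U ∘L l))
      (adjoint U - 1) = adjoint (blockOf k (-(adjoint l ∘L U)) l (U - 1)) := by
    rw [adjoint_blockOf]
    congr 1
    · simp [adjoint_comp, comp_assoc, hU']
      rfl
    · simp [adjoint_comp]
    · rw [map_sub, ← star_eq_adjoint 1, star_one]
  rwa [e, adjoint_adjoint] at key

end Blocks

section Dilation

variable {H K}

lemma mul_sqrt_eq_sqrt_mul {C D D' : K →L[ℂ] K} (hD : 0 ≤ D) (hD' : 0 ≤ D')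
    (h : C * (D * D) = (D' * D') * C) : C * D = D' * C := by
  have hS := blockOf_diag_nonneg hD hD'
  set S := blockOf D 0 0 D' with hSdef
  set X : E K K →L[ℂ] E K K := blockOf 0 0 C 0 with hX
  have hc : Commute (S * S) X := by
    simp only [Commute, SemiconjBy, hSdef, hX, blockOf_mul_blockOf]
    simp only [mul_def] at h
    simp [h]
  have hcS : Commute (CFC.sqrt (S * S)) X := hc.cfcₙ_nnreal _
  rw [CFC.sqrt_mul_self S] at hcS
  ext k
  have := congrArg (fun T => (T (inH K K k)).snd) hcS.eq
  simpa [hSdef, hX] using this.symm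

lemma one_sub_adjoint_mul_self_nonneg {C : K →L[ℂ] K} (hC : ‖C‖ ≤ 1) :
    0 ≤ 1 - adjoint C * C := by
  rw [nonneg_iff_isPositive, isPositive_def']
  refine ⟨.sub (.one _) (.star_mul_self C), fun x => ?_⟩
  have : ‖C x‖ ^ 2 ≤ ‖x‖ ^ 2 := by
    gcongr
    simpa using C.le_of_opNorm_le hC x
  simpa [reApplyInnerSelf_apply, inner_sub_left, adjoint_inner_left,
    inner_self_eq_norm_sq_to_K, ← Complex.ofReal_pow] using this

lemma exists_defect {C : K →L[ℂ] K} (hC : ‖C‖ ≤ 1) :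
    ∃ D D' : K →L[ℂ] K, 0 ≤ D ∧ 0 ≤ D' ∧ D * D = 1 - adjoint C * C ∧
      D' * D' = 1 - C * adjoint C ∧ C * D = D' * C := by
  have h := one_sub_adjoint_mul_self_nonneg hC
  have h' : 0 ≤ 1 - C * adjoint C := by
    simpa using one_sub_adjoint_mul_self_nonneg (C := adjoint C) (by simpa using hC)
  refine ⟨CFC.sqrt (1 - adjoint C * C), CFC.sqrt (1 - C * adjoint C), CFC.sqrt_nonneg _,
    CFC.sqrt_nonneg _, CFC.sqrt_mul_sqrt_self _, CFC.sqrt_mul_sqrt_self _,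
    mul_sqrt_eq_sqrt_mul (CFC.sqrt_nonneg _) (CFC.sqrt_nonneg _) ?_⟩
  rw [CFC.sqrt_mul_sqrt_self _, CFC.sqrt_mul_sqrt_self _]
  noncomm_ring

/-- The Halmos dilation of a contraction, extended by the identity on a further summand. -/
lemma exists_unitary_dilation {C : K →L[ℂ] K} (hC : ‖C‖ ≤ 1) :
    ∃ (U : K' H K →L[ℂ] K' H K) (D : K →L[ℂ] K), adjoint U ∘L U = 1 ∧ U ∘L adjoint U = 1 ∧
      D * D = 1 - adjoint C * C ∧ adjoint D = D ∧
      ∀ k, (U (inH K _ k)).fst = C k ∧ (U (inH K _ k)).snd = inH K H (D k) := by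
  obtain ⟨D, D', hD, hD', hDD, hDD', hCD⟩ := exists_defect hC
  have aD : adjoint D = D := hD.isSelfAdjoint
  have aD' : adjoint D' = D' := hD'.isSelfAdjoint
  have hCD' : D * adjoint C = adjoint C * D' := by
    have := congrArg adjoint hCD
    simpa [mul_def, adjoint_comp, aD, aD'] using this
  have e₁ k : D (D k) = k - adjoint C (C k) := congrArg (· k) hDD
  have e₂ k : D' (D' k) = k - C (adjoint C k) := congrArg (· k) hDD'
  have e₃ k : C (D k) = D' (C k) := congrArg (· k) hCD
  have e₄ k : D (adjoint C k) = adjoint C (D' k) := congrArg (· k) hCD'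
  let U : K' H K →L[ℂ] K' H K :=
    blockOf C (-(D' ∘L prH K H)) (inH K H ∘L D) (blockOf (adjoint C) 0 0 1)
  have hU : adjoint U =
      blockOf (adjoint C) (D ∘L prH K H) (-(inH K H ∘L D')) (blockOf C 0 0 1) := by
    have h2 : adjoint (1 : H →L[ℂ] H) = 1 := star_one _
    simp [U, adjoint_blockOf, adjoint_comp, adjoint_inH, adjoint_prH, aD, aD', h2]
  refine ⟨U, D, ?_, ?_, hDD, aD, fun k => ?_⟩
  · rw [hU]
    refine ContinuousLinearMap.ext fun x => E_ext ?_ (E_ext ?_ ?_)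
    · simp [U, e₁, e₄]
      abel
    · simp [U, e₂, e₃]
    · simp [U]
  · rw [hU]
    refine ContinuousLinearMap.ext fun x => E_ext ?_ (E_ext ?_ ?_)
    · simp [U, e₂, e₃]
    · simp [U, e₁, e₄]
      abel
    · simp [U]
  · constructor
    · simp [U]
    · simp [U]

/-- Douglas factorization: if `|⟪u, B k⟫| ≤ s u * ‖D k‖`, then `B` factors through `D`. -/
lemma exists_factorization {B : K →L[ℂ] H} {D : K →L[ℂ] K} {s : H → ℝ} {c : ℝ} (hc₀ : 0 ≤ c)
    (hc : ∀ u, s u ≤ c * ‖u‖) (hs : ∀ u, 0 ≤ s u)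
    (h : ∀ u k, (inner ℂ u (B k)).re ≤ s u * ‖D k‖) :
    ∃ X : K →L[ℂ] H, X ∘L D = B ∧ ∀ u, ‖adjoint X u‖ ≤ s u := by
  let R := (LinearMap.range (D : K →ₗ[ℂ] K)).topologicalClosure
  let e : K →ₗ[ℂ] R := LinearMap.codRestrict R (D : K →ₗ[ℂ] K) fun k =>
    Submodule.le_topologicalClosure _ ⟨k, rfl⟩
  have he : DenseRange e := by
    rw [DenseRange, Subtype.dense_iff]
    intro x hx
    rw [← Set.range_comp]
    exact hx
  have hB : ∀ k, ‖B k‖ ≤ c * ‖e k‖ := by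
    intro k
    have h₁ := h (B k) k
    rw [re_inner_self] at h₁
    have h₂ := mul_le_mul_of_nonneg_right (hc (B k)) (norm_nonneg (D k))
    rcases (norm_nonneg (B k)).eq_or_lt with h0 | h0
    · rw [← h0]
      positivity
    · change _ ≤ c * ‖D k‖
      nlinarith
  let X₀ : R →L[ℂ] H := LinearMap.extendOfNorm (B : K →ₗ[ℂ] H) e
  have hX₀ k : X₀ (e k) = B k := LinearMap.extendOfNorm_eq he ⟨c, hB⟩ k
  have hX₀' (u : H) (r : R) : (inner ℂ u (X₀ r)).re ≤ s u * ‖r‖ := by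
    refine he.induction_on r (isClosed_le (by fun_prop) (by fun_prop)) fun k => ?_
    rw [hX₀]
    exact h u k
  refine ⟨X₀ ∘L R.orthogonalProjectionOnto, ?_, fun u => ?_⟩
  · ext k
    rw [comp_apply, comp_apply, ← hX₀]
    congr 1
    exact R.orthogonalProjectionOnto_mem_subspace_eq_self (e k)
  · set X := X₀ ∘L R.orthogonalProjectionOnto
    have h₁ := hX₀' u (R.orthogonalProjectionOnto (adjoint X u))
    have h₂ : inner ℂ u (X₀ (R.orthogonalProjectionOnto (adjoint X u))) =
        inner ℂ (adjoint X u) (adjoint X u) := by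
      rw [adjoint_inner_left]; rfl
    rw [h₂, re_inner_self] at h₁
    have h₃ := mul_le_mul_of_nonneg_left
      (R.norm_orthogonalProjectionOnto_apply_le (adjoint X u)) (hs u)
    rcases (norm_nonneg (adjoint X u)).eq_or_lt with h0 | h0
    · rw [← h0]; exact hs u
    · nlinarith

end Dilation

section Compression

set_option linter.unusedSectionVars false

variable {H K}

lemma J_fst (v : E H K) : (J H K v).fst = v.fst := rfl

lemma J_snd (v : E H K) : (J H K v).snd = inH K (E K H) v.snd := rfl

lemma adjoint_J : adjoint (J H K) =
    inH H K ∘L prH H (K' H K) + inK H K ∘L prH K (E K H) ∘L prK H (K' H K) := by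
  symm
  rw [eq_adjoint_iff]
  intro x y
  simp [J_fst, J_snd]

lemma spForm_compression_le (F' : E H (K' H K) →L[ℂ] E H (K' H K)) (v : E H K) :
    spForm (adjoint (J H K) ∘L F' ∘L J H K) v ≤ spForm F' (J H K v) := by
  have h := E_norm_sq (F' (J H K v)).snd
  have h' : ((adjoint (J H K) ∘L F' ∘L J H K) v).snd = (F' (J H K v)).snd.fst := by
    simp [adjoint_J]
  rw [spForm, spForm, h', h]
  simp only [comp_apply, adjoint_inner_left]
  nlinarith [sq_nonneg ‖(F' (J H K v)).snd.snd‖]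

lemma exists_eq_blockOf (F : E H K →L[ℂ] E H K) : ∃ k m l n, F = blockOf k m l n := by
  refine ⟨prH H K ∘L F ∘L inH H K, prH H K ∘L F ∘L inK H K, prK H K ∘L F ∘L inH H K,
    prK H K ∘L F ∘L inK H K, ContinuousLinearMap.ext fun v => ?_⟩
  have hv : v = inH H K v.fst + inK H K v.snd := E_ext (by simp) (by simp)
  refine E_ext ?_ ?_
  · conv_lhs => rw [hv]
    simp
  · conv_lhs => rw [hv]
    simp

lemma le_sqrt_mul_sqrt_of_forall {a b d : ℝ} (hd : 0 ≤ d)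
    (h : ∀ t : ℝ, 0 ≤ d ^ 2 * (t * t) + 2 * b * t + a) : b ≤ √a * d := by
  have ha : 0 ≤ a := by simpa using h 0
  have := discrim_le_zero h
  rw [discrim] at this
  refine le_of_sq_le_sq ?_ (by positivity)
  rw [mul_pow, Real.sq_sqrt ha]
  linarith

lemma exists_dilation (F : E H K →L[ℂ] E H K) (hF : ∀ v, spForm F v ≤ 0) :
    ∃ F' : E H (K' H K) →L[ℂ] E H (K' H K),
      (sp (adjoint F') F' = 0 ∧ sp F' (adjoint F') = 0) ∧
      F = adjoint (J H K) ∘L F' ∘L J H K := by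
  obtain ⟨k, m, l, n, rfl⟩ := exists_eq_blockOf F
  set C := n + 1 with hCdef
  set B := -(m + adjoint l ∘L C) with hBdef
  set A := -(k + adjoint k + adjoint l ∘L l) with hAdef
  have hA u : (inner ℂ (A u) u).re = -(2 * (inner ℂ (k u) u).re + ‖l u‖ ^ 2) := by
    have : (inner ℂ u (k u)).re = (inner ℂ (k u) u).re := inner_re_symm (𝕜 := ℂ) _ _
    simp only [hAdef, neg_apply, add_apply, comp_apply, inner_neg_left, inner_add_left,
      adjoint_inner_left, Complex.neg_re, Complex.add_re, this, re_inner_self]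
    ring
  have hQ u ζ : 0 ≤ (inner ℂ (A u) u).re + 2 * (inner ℂ u (B ζ)).re + ‖ζ‖ ^ 2 - ‖C ζ‖ ^ 2 := by
    have h := hF (inH H K u + inK H K ζ)
    have c₁ (x y : H) : (inner ℂ x y).re = (inner ℂ y x).re := inner_re_symm (𝕜 := ℂ) x y
    have c₂ (x y : K) : (inner ℂ x y).re = (inner ℂ y x).re := inner_re_symm (𝕜 := ℂ) x y
    rw [hA]
    simp only [spForm, E_inner, blockOf_fst, blockOf_snd, map_add, WithLp.add_fst,
      WithLp.add_snd, inH_fst, inH_snd, inK_fst, inK_snd, map_zero, add_zero, zero_add] at h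
    simp only [hBdef, hCdef, ← re_inner_self, neg_apply, add_apply, comp_apply,
      inner_neg_right, inner_add_left, inner_add_right, adjoint_inner_right, one_apply_eq_self,
      Complex.neg_re, Complex.add_re] at h ⊢
    rw [c₁ u (m ζ)]
    linarith [c₂ (l u) ζ, c₂ (l u) (n ζ), c₂ ζ (n ζ)]
  have hC : ‖C‖ ≤ 1 := by
    refine C.opNorm_le_bound zero_le_one fun ζ => ?_
    have := hQ 0 ζ
    simp only [map_zero, inner_zero_left, Complex.zero_re] at this
    rw [one_mul]
    exact le_of_sq_le_sq (by linarith) (norm_nonneg _)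
  obtain ⟨U, D, hU, hU', hDD, hD, hUC⟩ := exists_unitary_dilation (H := H) hC
  have hDn ζ : ‖D ζ‖ ^ 2 = ‖ζ‖ ^ 2 - ‖C ζ‖ ^ 2 := by
    have : adjoint D (D ζ) = ζ - adjoint C (C ζ) := by
      rw [hD]
      exact congrArg (· ζ) hDD
    rw [← re_inner_self, ← adjoint_inner_left, this, inner_sub_left, adjoint_inner_left,
      Complex.sub_re, re_inner_self, re_inner_self]
  have hA₀ u : 0 ≤ (inner ℂ (A u) u).re := by simpa using hQ u 0
  have hAs u : √(inner ℂ (A u) u).re ≤ √‖A‖ * ‖u‖ := by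
    rw [← Real.sqrt_sq (norm_nonneg u), ← Real.sqrt_mul (norm_nonneg A)]
    refine Real.sqrt_le_sqrt ?_
    calc (inner ℂ (A u) u).re ≤ ‖A u‖ * ‖u‖ := re_inner_le_norm (𝕜 := ℂ) _ _
      _ ≤ ‖A‖ * ‖u‖ * ‖u‖ := by gcongr; exact A.le_opNorm u
      _ = ‖A‖ * ‖u‖ ^ 2 := by ring
  have hBD u ζ : (inner ℂ u (B ζ)).re ≤ √(inner ℂ (A u) u).re * ‖D ζ‖ := by
    refine le_sqrt_mul_sqrt_of_forall (norm_nonneg _) fun t => ?_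
    have h := hQ u ((t : ℂ) • ζ)
    simp only [map_smul, norm_smul, inner_smul_right, Complex.re_ofReal_mul, mul_pow,
      Complex.norm_real, Real.norm_eq_abs, sq_abs] at h
    rw [hDn]
    linarith
  obtain ⟨X, hXD, hX⟩ :=
    exists_factorization (Real.sqrt_nonneg _) hAs (fun _ => Real.sqrt_nonneg _) hBD
  have hXX u : (inner ℂ (X (adjoint X u)) u).re = ‖adjoint X u‖ ^ 2 := by
    rw [← adjoint_inner_right, re_inner_self]
  have hAX : 0 ≤ A - X ∘L adjoint X := by
    rw [nonneg_iff_isPositive, isPositive_def']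
    refine ⟨?_, fun u => ?_⟩
    · simp [hAdef, IsSelfAdjoint, star_eq_adjoint, adjoint_comp, add_comm]
    · have := Real.sq_sqrt (hA₀ u) ▸ pow_le_pow_left₀ (norm_nonneg _) (hX u) 2
      simpa [reApplyInnerSelf_apply, inner_sub_left, hXX] using this
  obtain ⟨y, hy, hyy⟩ : ∃ y : H →L[ℂ] H, 0 ≤ y ∧ y * y = A - X ∘L adjoint X :=
    ⟨_, CFC.sqrt_nonneg _, CFC.sqrt_mul_sqrt_self _⟩
  have hyn u : ‖y u‖ ^ 2 = (inner ℂ (A u) u).re - ‖adjoint X u‖ ^ 2 := by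
    have h₁ : adjoint y = y := hy.isSelfAdjoint
    have h₂ : adjoint y (y u) = A u - X (adjoint X u) := by
      rw [h₁]
      exact congrArg (· u) hyy
    rw [← re_inner_self, ← adjoint_inner_left, h₂, inner_sub_left, Complex.sub_re, hXX]
  let l' : H →L[ℂ] K' H K :=
    inH K (E K H) ∘L l + inK K (E K H) ∘L (inH K H ∘L adjoint X + inK K H ∘L y)
  have hl' u : 2 * (inner ℂ (k u) u).re + ‖l' u‖ ^ 2 = 0 := by
    have h₁ : ‖l' u‖ ^ 2 = ‖l u‖ ^ 2 + (‖adjoint X u‖ ^ 2 + ‖y u‖ ^ 2) := by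
      simp [l', E_norm_sq]
    rw [h₁, hyn, hA]
    ring
  have hl'U ζ : adjoint l' (U (inH K _ ζ)) = - m ζ := by
    refine ext_inner_right ℂ fun u => ?_
    have : X (D ζ) = B ζ := congrArg (· ζ) hXD
    have : inner ℂ (D ζ) (adjoint X u) = inner ℂ (B ζ) u := by
      rw [adjoint_inner_right, this]
    rw [adjoint_inner_left, E_inner, (hUC ζ).1, (hUC ζ).2]
    simp [l', this, hBdef, adjoint_inner_left]
  refine ⟨blockOf k (-(adjoint l' ∘L U)) l' (U - 1), sp_eq_zero_of_unitary hU hU' hl',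
    ContinuousLinearMap.ext fun v => E_ext ?_ ?_⟩
  · simp [adjoint_J, J_snd, J_fst, hl'U]
  · simp [adjoint_J, J_snd, J_fst, (hUC _).1, l', hCdef]

end Compression

/-- The contractive generators on `𝔥 ⊕ 𝔎` are exactly the compressions
by `J` of the `𝔲`-class generators on `𝔥 ⊕ 𝔎'`. -/
theorem c_is_compression_of_u :
    {F : E H K →L[ℂ] E H K | opLe (sp (adjoint F) F) 0} =
      {G : E H K →L[ℂ] E H K |
        ∃ F' : E H (K' H K) →L[ℂ] E H (K' H K),
          (sp (adjoint F') F' = 0 ∧ sp F' (adjoint F') = 0) ∧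
          G = adjoint (J H K) ∘L F' ∘L J H K} := by
  ext F
  simp only [Set.mem_ofPred_eq, opLe_sp_adjoint_zero_iff]
  refine ⟨exists_dilation F, ?_⟩
  rintro ⟨F', ⟨h, -⟩, rfl⟩ v
  exact (spForm_compression_le F' v).trans_eq ((sp_adjoint_eq_zero_iff F').1 h _)

end QS
end
end

section
/- Let F ∈ B(𝔥⊕𝔎) have block matrix form [K, M; L, C − I] and let β₀ ∈ ℝ satisfy F* ⋄ F ≤ 2β₀Δ⊥. Define (writing re K := ½(K + K*) and im K := (K − K*)/(2i)): F₁ := [β₀I + i·im K, 0; 0, 0], F₂ˡ := [−½L*L, −L*; L, 0], F₃ʳ := [−½MM*, M; −M*, 0], F₃ˡ := [re K + ½L*L − β₀I, M + L*C; 0, C − I], F₂ʳ := [re K + ½MM* − β₀I, 0; L + CM*, C − I]. Then: F₁ = Δ⊥F₁Δ⊥; F₂ˡ and F₃ʳ satisfy G* ⋄ G = 0 = G ⋄ G*; F₃ˡ and F₂ʳ satisfy G* ⋄ G ≤ 0; and F = F₁ ⋄ F₂ˡ ⋄ F₃ˡ = F₁ ⋄ F₂ʳ ⋄ F₃ʳ.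 -/
noncomputable section

open ContinuousLinearMap

namespace QS

variable (H K : Type*) [NormedAddCommGroup H] [InnerProductSpace ℂ H] [CompleteSpace H]
  [NormedAddCommGroup K] [InnerProductSpace ℂ K] [CompleteSpace K]

variable {H K}

set_option linter.unusedSectionVars false

lemma blockOf_apply (A : H →L[ℂ] H) (B : K →L[ℂ] H) (C : H →L[ℂ] K) (D : K →L[ℂ] K)
    (x : E H K) :
    blockOf A B C D x = WithLp.toLp 2 (A x.fst + B x.snd, C x.fst + D x.snd) := by
  apply WithLp.ofLp_injective
  ext <;> simp [blockOf, inH, inK, prH, prK, eE]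

lemma Dl_eq_blockOf : Dl H K = blockOf 0 0 0 1 := by
  simp [Dl, blockOf, one_def]

lemma one_eq_blockOf : (1 : E H K →L[ℂ] E H K) = blockOf 1 0 0 1 := by
  ext x : 1
  simp [blockOf_apply]
  rfl

lemma blockOf_add (A A' : H →L[ℂ] H) (B B' : K →L[ℂ] H) (C C' : H →L[ℂ] K)
    (D D' : K →L[ℂ] K) :
    blockOf A B C D + blockOf A' B' C' D' = blockOf (A + A') (B + B') (C + C') (D + D') := by
  simp only [blockOf, add_comp, comp_add]
  abel

lemma blockOf_sub (A A' : H →L[ℂ] H) (B B' : K →L[ℂ] H) (C C' : H →L[ℂ] K)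
    (D D' : K →L[ℂ] K) :
    blockOf A B C D - blockOf A' B' C' D' = blockOf (A - A') (B - B') (C - C') (D - D') := by
  simp only [blockOf, sub_comp, comp_sub]
  abel

lemma smul_blockOf (c : ℂ) (A : H →L[ℂ] H) (B : K →L[ℂ] H) (C : H →L[ℂ] K) (D : K →L[ℂ] K) :
    c • blockOf A B C D = blockOf (c • A) (c • B) (c • C) (c • D) := by
  simp only [blockOf, smul_comp, comp_smul, smul_add]

lemma blockOf_mul (A A' : H →L[ℂ] H) (B B' : K →L[ℂ] H) (C C' : H →L[ℂ] K)
    (D D' : K →L[ℂ] K) :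
    blockOf A B C D * blockOf A' B' C' D' =
      blockOf (A ∘L A' + B ∘L C') (A ∘L B' + B ∘L D')
        (C ∘L A' + D ∘L C') (C ∘L B' + D ∘L D') := by
  ext x : 1
  simp only [mul_def, blockOf_apply, map_add, add_apply, comp_apply, WithLp.fst, WithLp.snd]
  congr 2 <;> abel

lemma adjoint_blockOf_s12 (A : H →L[ℂ] H) (B : K →L[ℂ] H) (C : H →L[ℂ] K) (D : K →L[ℂ] K) :
    adjoint (blockOf A B C D) = blockOf (adjoint A) (adjoint C) (adjoint B) (adjoint D) := by
  symm
  rw [eq_adjoint_iff]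
  intro x y
  simp only [blockOf_apply, WithLp.prod_inner_apply, inner_add_left, inner_add_right,
    adjoint_inner_left, WithLp.fst, WithLp.snd]
  ring

lemma blockOf_zero : blockOf (0 : H →L[ℂ] H) (0 : K →L[ℂ] H) 0 0 = 0 := by
  simp [blockOf]

lemma Dp_eq_blockOf : Dp H K = blockOf 1 0 0 0 := by
  rw [Dp, one_eq_blockOf, Dl_eq_blockOf, blockOf_sub]
  simp

lemma HasBlock.eq_blockOf {F : E H K →L[ℂ] E H K} {A : H →L[ℂ] H} {B : K →L[ℂ] H}
    {C : H →L[ℂ] K} {D : K →L[ℂ] K} (h : HasBlock F A B C D) : F = blockOf A B C D := by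
  ext x : 1
  rw [blockOf_apply]
  exact h x.fst x.snd

lemma sp_blockOf (A A' : H →L[ℂ] H) (B B' : K →L[ℂ] H) (C C' : H →L[ℂ] K)
    (D D' : K →L[ℂ] K) :
    sp (blockOf A B C D) (blockOf A' B' C' D') =
      blockOf (A + B ∘L C' + A') (B + B ∘L D' + B')
        (C + D ∘L C' + C') (D + D ∘L D' + D') := by
  simp [sp, Dl_eq_blockOf, blockOf_mul, blockOf_add, one_def]

lemma adjoint_inv_two_smul (T : H →L[ℂ] H) :
    adjoint ((2⁻¹ : ℂ) • T) = (2⁻¹ : ℂ) • adjoint T := by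
  rw [map_smulₛₗ, map_inv₀, Complex.conj_ofNat]

lemma adjoint_real_smul (r : ℝ) (T : H →L[ℂ] H) :
    adjoint (r • T) = r • adjoint T := by
  rw [← Complex.coe_smul, map_smulₛₗ, Complex.conj_ofReal, Complex.coe_smul]

lemma adjoint_one_eq : adjoint (1 : K →L[ℂ] K) = 1 := by
  rw [← star_eq_adjoint, star_one]

/-- The dissipation of a generator `[A, B; L, C - 1]`. -/
lemma sp_adjoint_blockOf (A : H →L[ℂ] H) (B : K →L[ℂ] H) (L : H →L[ℂ] K) (C : K →L[ℂ] K) :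
    sp (adjoint (blockOf A B L (C - 1))) (blockOf A B L (C - 1)) =
      blockOf (adjoint A + A + adjoint L ∘L L) (B + adjoint L ∘L C)
        (adjoint B + adjoint C ∘L L) (adjoint C ∘L C - 1) := by
  rw [adjoint_blockOf_s12, sp_blockOf]
  simp only [map_sub, adjoint_one_eq]
  congr 1 <;> ext x <;> simp <;> abel

lemma conj_shear_blockOf (A : H →L[ℂ] H) (B M : K →L[ℂ] H) (C : H →L[ℂ] K) (D : K →L[ℂ] K) :
    adjoint (blockOf 1 0 (adjoint M) 1) ∘L blockOf A B C D ∘L blockOf 1 0 (adjoint M) 1 =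
      blockOf (A + B ∘L adjoint M + M ∘L C + M ∘L D ∘L adjoint M) (B + M ∘L D)
        (C + D ∘L adjoint M) D := by
  rw [adjoint_blockOf_s12, ← mul_def (blockOf _ _ _ _) (blockOf _ _ _ _), blockOf_mul,
    ← mul_def (blockOf _ _ _ _) (blockOf _ _ _ _), blockOf_mul]
  simp only [adjoint_one_eq, adjoint_adjoint, map_zero]
  congr 1 <;> ext x <;> simp
  abel

set_option maxHeartbeats 1000000 in
/-- Left and right series decompositions of a quasicontractive
stochastic generator `F = [K, M; L, C − I]` with `F* ⋄ F ≤ 2β₀Δ⊥`: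
`F = F₁ ⋄ F₂ˡ ⋄ F₃ˡ = F₁ ⋄ F₂ʳ ⋄ F₃ʳ`, where `F₁` is central, `F₂ˡ, F₃ʳ ∈ 𝔲` and
`F₃ˡ, F₂ʳ ∈ 𝔠`. -/
theorem left_right_series_decomposition
    (F : E H K →L[ℂ] E H K) (Kc : H →L[ℂ] H) (M : K →L[ℂ] H) (L : H →L[ℂ] K)
    (C : K →L[ℂ] K) (β₀ : ℝ)
    (hF : HasBlock F Kc M L (C - 1))
    (hβ : opLe (sp (adjoint F) F) (((2 * β₀ : ℝ) : ℂ) • Dp H K))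
    (reK imK : H →L[ℂ] H)
    (hre : reK = (2⁻¹ : ℂ) • (Kc + adjoint Kc))
    (him : imK = (2 * Complex.I)⁻¹ • (Kc - adjoint Kc))
    (F₁ F₂l F₃r F₃l F₂r : E H K →L[ℂ] E H K)
    (hF₁ : F₁ = blockOf ((β₀ : ℂ) • 1 + Complex.I • imK) 0 0 0)
    (hF₂l : F₂l = blockOf ((-(2⁻¹ : ℂ)) • (adjoint L ∘L L)) (-(adjoint L)) L 0)
    (hF₃r : F₃r = blockOf ((-(2⁻¹ : ℂ)) • (M ∘L adjoint M)) M (-(adjoint M)) 0)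
    (hF₃l : F₃l = blockOf (reK + (2⁻¹ : ℂ) • (adjoint L ∘L L) - (β₀ : ℂ) • 1)
      (M + adjoint L ∘L C) 0 (C - 1))
    (hF₂r : F₂r = blockOf (reK + (2⁻¹ : ℂ) • (M ∘L adjoint M) - (β₀ : ℂ) • 1)
      0 (L + C ∘L adjoint M) (C - 1)) :
    F₁ = Dp H K * F₁ * Dp H K ∧
    (sp (adjoint F₂l) F₂l = 0 ∧ sp F₂l (adjoint F₂l) = 0) ∧
    (sp (adjoint F₃r) F₃r = 0 ∧ sp F₃r (adjoint F₃r) = 0) ∧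
    opLe (sp (adjoint F₃l) F₃l) 0 ∧ opLe (sp (adjoint F₂r) F₂r) 0 ∧
    F = sp F₁ (sp F₂l F₃l) ∧ F = sp F₁ (sp F₂r F₃r) := by
  have hKre : reK + Complex.I • imK = Kc := by
    have hI : Complex.I * (2 * Complex.I)⁻¹ = 2⁻¹ := by
      field_simp
    rw [hre, him, smul_smul, hI]
    module
  have hadj : adjoint reK = reK := by
    simp [hre, adjoint_inv_two_smul, add_comm]
  have hre2 : reK + reK = adjoint Kc + Kc := by
    rw [hre]
    module
  have hQ : (((2 * β₀ : ℝ) : ℂ) • Dp H K - sp (adjoint F) F) =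
      blockOf (((2 * β₀ : ℝ) : ℂ) • 1 - (reK + reK + adjoint L ∘L L))
        (-(M + adjoint L ∘L C)) (-(adjoint M + adjoint C ∘L L)) (1 - adjoint C ∘L C) := by
    rw [hF.eq_blockOf, sp_adjoint_blockOf, Dp_eq_blockOf, smul_blockOf, blockOf_sub, hre2]
    simp
  rw [opLe, hQ] at hβ
  refine ⟨?_, ⟨?_, ?_⟩, ⟨?_, ?_⟩, ?_, ?_, ?_, ?_⟩
  · rw [hF₁, Dp_eq_blockOf, blockOf_mul, blockOf_mul]
    simp [one_def]
  · rw [hF₂l, adjoint_blockOf_s12, sp_blockOf, ← blockOf_zero]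
    congr 1 <;> ext x <;> simp [adjoint_comp, adjoint_inv_two_smul] <;> module
  · rw [hF₂l, adjoint_blockOf_s12, sp_blockOf, ← blockOf_zero]
    congr 1 <;> ext x <;> simp [adjoint_comp, adjoint_inv_two_smul] <;> module
  · rw [hF₃r, adjoint_blockOf_s12, sp_blockOf, ← blockOf_zero]
    congr 1 <;> ext x <;> simp [adjoint_comp, adjoint_inv_two_smul] <;> module
  · rw [hF₃r, adjoint_blockOf_s12, sp_blockOf, ← blockOf_zero]
    congr 1 <;> ext x <;> simp [adjoint_comp, adjoint_inv_two_smul] <;> module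
  · rw [opLe, hF₃l, sp_adjoint_blockOf]
    convert hβ using 1
    rw [← blockOf_zero, blockOf_sub]
    congr 1 <;> ext x <;> simp [adjoint_comp, adjoint_inv_two_smul, adjoint_real_smul, hadj,
      adjoint_one_eq]
    module
  · rw [opLe, hF₂r, sp_adjoint_blockOf]
    convert hβ.adjoint_conj (blockOf 1 0 (adjoint M) 1) using 1
    rw [← blockOf_zero, blockOf_sub, conj_shear_blockOf]
    congr 1 <;> ext x <;> simp [adjoint_comp, adjoint_inv_two_smul, adjoint_real_smul, hadj,
      adjoint_one_eq] <;> module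
  · rw [hF.eq_blockOf, hF₁, hF₂l, hF₃l, sp_blockOf, sp_blockOf, ← hKre]
    congr 1 <;> ext x <;> simp <;> module
  · rw [hF.eq_blockOf, hF₁, hF₂r, hF₃r, sp_blockOf, sp_blockOf, ← hKre]
    congr 1 <;> ext x <;> simp <;> module

end QS
end
end

section
/- Let 𝔎 = 𝔎₁ ⊕ 𝔎₂ be an orthogonal decomposition of 𝔎. Define ι : B(𝔥⊕𝔎₁) → B(𝔥⊕𝔎) by sending the operator with block matrix form [K, M; L, N] (with respect to 𝔥⊕𝔎₁) to the operator with block matrix form [K, M, 0; L, N, 0; 0, 0, 0] (with respect to 𝔥⊕𝔎₁⊕𝔎₂), and define ι' : B(𝔥⊕𝔎₂) → B(𝔥⊕𝔎) by sending [K, M; L, N] (with respect to 𝔥⊕𝔎₂) to [K, 0, M; 0, 0, 0; L, 0, N] (with respect to 𝔥⊕𝔎₁⊕𝔎₂). Then for all F₁ ∈ B(𝔥⊕𝔎₁) and F₂ ∈ B(𝔥⊕𝔎₂): ι(F₁) Δ ι'(F₂) = 0 = ι'(F₂) Δ ι(F₁), and consequently the concatenation product F₁ ⊞ F₂ := ι(F₁)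 + ι'(F₂) satisfies F₁ ⊞ F₂ = ι(F₁) ⋄ ι'(F₂) = ι'(F₂) ⋄ ι(F₁). -/
noncomputable section

open ContinuousLinearMap

namespace QS

variable (H K : Type*) [NormedAddCommGroup H] [InnerProductSpace ℂ H] [CompleteSpace H]
  [NormedAddCommGroup K] [InnerProductSpace ℂ K] [CompleteSpace K]

variable {H K}

variable (H K)
variable (K₁ K₂ : Type*) [NormedAddCommGroup K₁] [InnerProductSpace ℂ K₁] [CompleteSpace K₁]
  [NormedAddCommGroup K₂] [InnerProductSpace ℂ K₂] [CompleteSpace K₂]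

/-- The projection `𝔥 ⊕ 𝔎 → 𝔥 ⊕ 𝔎₁`, `u ⊕ (ζ₁ ⊕ ζ₂) ↦ u ⊕ ζ₁`. -/
def P₁ : E H (Kd K₁ K₂) →L[ℂ] E H K₁ :=
  (((eE H K₁).symm : H × K₁ →L[ℂ] E H K₁)).comp
    ((ContinuousLinearMap.prodMap (ContinuousLinearMap.id ℂ H)
      ((ContinuousLinearMap.fst ℂ K₁ K₂).comp
        ((WithLp.prodContinuousLinearEquiv 2 ℂ K₁ K₂ : Kd K₁ K₂ →L[ℂ] K₁ × K₂)))).comp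
      ((eE H (Kd K₁ K₂) : E H (Kd K₁ K₂) →L[ℂ] H × Kd K₁ K₂)))

/-- The isometry `𝔥 ⊕ 𝔎₂ → 𝔥 ⊕ 𝔎`, `u ⊕ ζ ↦ u ⊕ (0 ⊕ ζ)`. -/
def J₂ : E H K₂ →L[ℂ] E H (Kd K₁ K₂) :=
  (((eE H (Kd K₁ K₂)).symm : H × Kd K₁ K₂ →L[ℂ] E H (Kd K₁ K₂))).comp
    ((ContinuousLinearMap.prodMap (ContinuousLinearMap.id ℂ H)
      ((((WithLp.prodContinuousLinearEquiv 2 ℂ K₁ K₂).symm :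
          K₁ × K₂ →L[ℂ] Kd K₁ K₂)).comp (ContinuousLinearMap.inr ℂ K₁ K₂))).comp
      ((eE H K₂ : E H K₂ →L[ℂ] H × K₂)))

/-- The projection `𝔥 ⊕ 𝔎 → 𝔥 ⊕ 𝔎₂`, `u ⊕ (ζ₁ ⊕ ζ₂) ↦ u ⊕ ζ₂`. -/
def P₂ : E H (Kd K₁ K₂) →L[ℂ] E H K₂ :=
  (((eE H K₂).symm : H × K₂ →L[ℂ] E H K₂)).comp
    ((ContinuousLinearMap.prodMap (ContinuousLinearMap.id ℂ H)
      ((ContinuousLinearMap.snd ℂ K₁ K₂).comp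
        ((WithLp.prodContinuousLinearEquiv 2 ℂ K₁ K₂ : Kd K₁ K₂ →L[ℂ] K₁ × K₂)))).comp
      ((eE H (Kd K₁ K₂) : E H (Kd K₁ K₂) →L[ℂ] H × Kd K₁ K₂)))

/-- The ampliation `ι : B(𝔥⊕𝔎₁) → B(𝔥⊕𝔎)` sending `[K, M; L, N]` to
`[K, M, 0; L, N, 0; 0, 0, 0]`. -/
def iota (F : E H K₁ →L[ℂ] E H K₁) : E H (Kd K₁ K₂) →L[ℂ] E H (Kd K₁ K₂) :=
  J₁ H K₁ K₂ ∘L F ∘L P₁ H K₁ K₂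

/-- The ampliation `ι' : B(𝔥⊕𝔎₂) → B(𝔥⊕𝔎)` sending `[K, M; L, N]` to
`[K, 0, M; 0, 0, 0; L, 0, N]`. -/
def iota' (F : E H K₂ →L[ℂ] E H K₂) : E H (Kd K₁ K₂) →L[ℂ] E H (Kd K₁ K₂) :=
  J₂ H K₁ K₂ ∘L F ∘L P₂ H K₁ K₂

omit [CompleteSpace H] [CompleteSpace K₁] [CompleteSpace K₂] in
theorem P₁_comp_Dl_comp_J₂ : P₁ H K₁ K₂ ∘L Dl H (Kd K₁ K₂) ∘L J₂ H K₁ K₂ = 0 :=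
  ContinuousLinearMap.ext fun _ => rfl

omit [CompleteSpace H] [CompleteSpace K₁] [CompleteSpace K₂] in
theorem P₂_comp_Dl_comp_J₁ : P₂ H K₁ K₂ ∘L Dl H (Kd K₁ K₂) ∘L J₁ H K₁ K₂ = 0 :=
  ContinuousLinearMap.ext fun _ => rfl

omit [CompleteSpace H] [CompleteSpace K₁] [CompleteSpace K₂] in
theorem iota_mul_Dl_mul_iota' (F₁ : E H K₁ →L[ℂ] E H K₁) (F₂ : E H K₂ →L[ℂ] E H K₂) :
    iota H K₁ K₂ F₁ * Dl H (Kd K₁ K₂) * iota' H K₁ K₂ F₂ = 0 := by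
  ext1 x
  have h := DFunLike.congr_fun (P₁_comp_Dl_comp_J₂ H K₁ K₂) (F₂ (P₂ H K₁ K₂ x))
  simp only [comp_apply, zero_apply] at h
  simp only [iota, iota', ContinuousLinearMap.mul_def, comp_apply, h, map_zero, zero_apply]

omit [CompleteSpace H] [CompleteSpace K₁] [CompleteSpace K₂] in
theorem iota'_mul_Dl_mul_iota (F₁ : E H K₁ →L[ℂ] E H K₁) (F₂ : E H K₂ →L[ℂ] E H K₂) :
    iota' H K₁ K₂ F₂ * Dl H (Kd K₁ K₂) * iota H K₁ K₂ F₁ = 0 := by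
  ext1 x
  have h := DFunLike.congr_fun (P₂_comp_Dl_comp_J₁ H K₁ K₂) (F₁ (P₁ H K₁ K₂ x))
  simp only [comp_apply, zero_apply] at h
  simp only [iota, iota', ContinuousLinearMap.mul_def, comp_apply, h, map_zero, zero_apply]

/-- `ι(F₁) Δ ι'(F₂) = 0 = ι'(F₂) Δ ι(F₁)`, and consequently the
concatenation product `F₁ ⊞ F₂ := ι(F₁) + ι'(F₂)` coincides with both series products
`ι(F₁) ⋄ ι'(F₂)` and `ι'(F₂) ⋄ ι(F₁)`. -/
theorem concatenation_is_series (F₁ : E H K₁ →L[ℂ] E H K₁) (F₂ : E H K₂ →L[ℂ] E H K₂) :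
    iota H K₁ K₂ F₁ * Dl H (Kd K₁ K₂) * iota' H K₁ K₂ F₂ = 0 ∧
    iota' H K₁ K₂ F₂ * Dl H (Kd K₁ K₂) * iota H K₁ K₂ F₁ = 0 ∧
    iota H K₁ K₂ F₁ + iota' H K₁ K₂ F₂ = sp (iota H K₁ K₂ F₁) (iota' H K₁ K₂ F₂) ∧
    iota H K₁ K₂ F₁ + iota' H K₁ K₂ F₂ = sp (iota' H K₁ K₂ F₂) (iota H K₁ K₂ F₁) := by
  have h := iota_mul_Dl_mul_iota' H K₁ K₂ F₁ F₂
  have h' := iota'_mul_Dl_mul_iota H K₁ K₂ F₁ F₂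
  refine ⟨h, h', ?_, ?_⟩
  · rw [sp, h, add_zero]
  · rw [sp, h', add_zero, add_comm]

end QS
end
end
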